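/- arXiv:2206.09879 — 6 statements merged into one kernel-verified Lean document; each statement's English description precedes it below -/
import Mathlib

section
/- Spectrum of a direct integral via pseudospectra of the fibers (Theorem 3.8): Let H be a separable complex Hilbert space, let μ be Lebesgue measure on I = [0, 2π], and let A : I → B(H) be a family of bounded operators with sup_{q∈I} ‖A q‖ < ∞ such that for every λ ∈ ℂ and every ε > 0 the set {q ∈ I : λ ∈ σ_ε(A q)} is Lebesgue measurable. Suppose T is a bounded operator on the Bochner space L²(I, H; μ) which acts fiberwise: for every f ∈ L²(I, H; μ), (T f)(q) = (A q)(f q) for μ-almost every q ∈ I. Then for every ε > 0, σ(T) ⊆ {λ ∈ ℂ : μ({q ∈ I : λ ∈ σ_ε(A q)}) > 0}, and moreover σ(T) = ⋂_{ε>0} {λ ∈ ℂ : μ({q ∈ I : λ ∈ σ_ε(A q)}) > 0}. -/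
open MeasureTheory Real

/-- The `ε`-pseudospectrum of an element `B` of a complex Banach algebra. -/
noncomputable def pseudospectrum {A : Type*} [NormedRing A] [NormedAlgebra ℂ A]
    (ε : ℝ) (B : A) : Set ℂ :=
  {z : ℂ | ¬ IsUnit (B - algebraMap ℂ A z) ∨
    (IsUnit (B - algebraMap ℂ A z) ∧ 1 / ε ≤ ‖Ring.inverse (B - algebraMap ℂ A z)‖)}

open scoped NNReal

namespace ContinuousLinearMap

variable {E : Type*} [NormedAddCommGroup E] [InnerProductSpace ℂ E]

/-- An operator that is bounded below and has dense range is invertible. -/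
lemma isUnit_of_bound_of_denseRange [CompleteSpace E] {B : E →L[ℂ] E} {K : ℝ≥0}
    (hK : ∀ x, ‖x‖ ≤ K * ‖B x‖) (hd : DenseRange B) : IsUnit B := by
  rw [isUnit_iff_bijective, bijective_iff_dense_range_and_antilipschitz]
  refine ⟨?_, K, B.antilipschitz_of_bound hK⟩
  simpa [SetLike.ext'_iff] using! hd.closure_eq

lemma inverse_apply_apply {B : E →L[ℂ] E} (hB : IsUnit B) (x : E) : Ring.inverse B (B x) = x :=
  DFunLike.congr_fun (Ring.inverse_mul_cancel B hB) x

lemma apply_inverse_apply {B : E →L[ℂ] E} (hB : IsUnit B) (x : E) : B (Ring.inverse B x) = x :=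
  DFunLike.congr_fun (Ring.mul_inverse_cancel B hB) x

lemma norm_le_norm_inverse_mul {B : E →L[ℂ] E} (hB : IsUnit B) (x : E) :
    ‖x‖ ≤ ‖Ring.inverse B‖ * ‖B x‖ := by
  simpa only [inverse_apply_apply hB] using (Ring.inverse B).le_opNorm (B x)

end ContinuousLinearMap

/-- The norms of two functions compare almost everywhere if their `L²` seminorms compare on every
set of finite measure. -/
lemma ae_enorm_le_of_forall_eLpNorm_restrict_le {α E : Type*} [MeasurableSpace α] {μ : Measure α}
    [SigmaFinite μ] [NormedAddCommGroup E] {f g : α → E} (hf : AEStronglyMeasurable f μ)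
    (h : ∀ s, MeasurableSet s → μ s < ⊤ →
      eLpNorm f 2 (μ.restrict s) ≤ eLpNorm g 2 (μ.restrict s)) :
    ∀ᵐ x ∂μ, ‖f x‖ₑ ≤ ‖g x‖ₑ := by
  have key : (fun x ↦ ‖f x‖ₑ ^ (2 : ℝ)) ≤ᵐ[μ] fun x ↦ ‖g x‖ₑ ^ (2 : ℝ) := by
    refine ae_le_of_forall_setLIntegral_le_of_sigmaFinite₀ (hf.enorm.pow_const _) fun s hs hμs ↦ ?_
    have := h s hs hμs
    simp only [eLpNorm_eq_lintegral_rpow_enorm_toReal two_ne_zero ENNReal.ofNat_ne_top,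
      ENNReal.toReal_ofNat] at this
    exact (ENNReal.rpow_le_rpow_iff (by norm_num)).1 this
  filter_upwards [key] with x hx
  exact (ENNReal.rpow_le_rpow_iff (by norm_num)).1 hx

section Fiberwise

variable {α H : Type*} [MeasurableSpace α] {μ : Measure α} [IsFiniteMeasure μ]
  [NormedAddCommGroup H] [InnerProductSpace ℂ H]
  {B : α → H →L[ℂ] H} {S : Lp H 2 μ →L[ℂ] Lp H 2 μ}

/-- A fiberwise operator commutes with restriction of constant functions to measurable sets. -/
lemma fiberwise_indicatorConstLp_ae_eq (hS : ∀ f : Lp H 2 μ, ∀ᵐ q ∂μ, S f q = B q (f q))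
    {s : Set α} (hs : MeasurableSet s) (v : H) :
    S (indicatorConstLp 2 hs (measure_ne_top μ s) v) =ᵐ[μ] s.indicator (S (Lp.const 2 μ v)) := by
  filter_upwards [hS (indicatorConstLp 2 hs (measure_ne_top μ s) v), hS (Lp.const 2 μ v),
    indicatorConstLp_coeFn (p := 2) (hs := hs) (hμs := measure_ne_top μ s) (c := v),
    Lp.coeFn_const (p := 2) (μ := μ) (c := v)] with q h₁ h₂ h₃ h₄
  rw [h₁, h₃]
  by_cases hq : q ∈ s
  · rw [Set.indicator_of_mem hq, Set.indicator_of_mem hq, h₂, h₄, Function.const_apply]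
  · rw [Set.indicator_of_notMem hq, Set.indicator_of_notMem hq, map_zero]

variable [SecondCountableTopology H]

/-- If a fiberwise operator is bounded below, then so is almost every fiber. -/
lemma ae_forall_norm_le_of_fiberwise (hS : ∀ f : Lp H 2 μ, ∀ᵐ q ∂μ, S f q = B q (f q))
    {K : ℝ≥0} (hK : ∀ f, ‖f‖ ≤ K * ‖S f‖) : ∀ᵐ q ∂μ, ∀ v, ‖v‖ ≤ K * ‖B q v‖ := by
  have hpt (v : H) : ∀ᵐ q ∂μ, ‖v‖ ≤ K * ‖B q v‖ := by
    have hle : ∀ᵐ q ∂μ, ‖v‖ₑ ≤ ‖((K : ℝ) : ℂ) • S (Lp.const 2 μ v) q‖ₑ := by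
      refine ae_enorm_le_of_forall_eLpNorm_restrict_le (f := fun _ ↦ v)
        (g := ((K : ℝ) : ℂ) • ⇑(S (Lp.const 2 μ v))) aestronglyMeasurable_const fun s hs _ ↦ ?_
      have hn : ‖indicatorConstLp 2 hs (measure_ne_top μ s) v‖ₑ
          ≤ ‖((K : ℝ) : ℂ)‖ₑ * ‖S (indicatorConstLp 2 hs (measure_ne_top μ s) v)‖ₑ := by
        rw [← enorm_smul, enorm_le_iff_norm_le, norm_smul]
        simpa using hK (indicatorConstLp 2 hs (measure_ne_top μ s) v)
      rw [Lp.enorm_def, Lp.enorm_def, eLpNorm_congr_ae indicatorConstLp_coeFn,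
        eLpNorm_congr_ae (fiberwise_indicatorConstLp_ae_eq hS hs v),
        eLpNorm_indicator_eq_eLpNorm_restrict hs, eLpNorm_indicator_eq_eLpNorm_restrict hs] at hn
      rwa [eLpNorm_const_smul]
    filter_upwards [hle, hS (Lp.const 2 μ v), Lp.coeFn_const (p := 2) (μ := μ) (c := v)]
      with q h₁ h₂ h₃
    rw [h₂, h₃, enorm_le_iff_norm_le, norm_smul] at h₁
    simpa using h₁
  have hall : ∀ᵐ q ∂μ, ∀ n, ‖TopologicalSpace.denseSeq H n‖
      ≤ K * ‖B q (TopologicalSpace.denseSeq H n)‖ := ae_all_iff.2 fun n ↦ hpt _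
  filter_upwards [hall] with q hq v
  refine (TopologicalSpace.denseRange_denseSeq H).induction_on
    (p := fun v ↦ ‖v‖ ≤ K * ‖B q v‖) v ?_ hq
  exact isClosed_le continuous_norm (by fun_prop)

/-- If a fiberwise operator is surjective, then almost every fiber has dense range. -/
lemma ae_denseRange_of_fiberwise (hS : ∀ f : Lp H 2 μ, ∀ᵐ q ∂μ, S f q = B q (f q))
    (hsurj : Function.Surjective S) : ∀ᵐ q ∂μ, DenseRange (B q) := by
  have hall : ∀ᵐ q ∂μ, ∀ n, TopologicalSpace.denseSeq H n ∈ Set.range (B q) := by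
    refine ae_all_iff.2 fun n ↦ ?_
    obtain ⟨f, hf⟩ := hsurj (Lp.const 2 μ (TopologicalSpace.denseSeq H n))
    filter_upwards [hS f, Lp.coeFn_const (p := 2) (μ := μ) (c := TopologicalSpace.denseSeq H n)]
      with q h₁ h₂
    refine ⟨f q, ?_⟩
    rw [← h₁, hf, h₂, Function.const_apply]
  filter_upwards [hall] with q hq
  exact (TopologicalSpace.denseRange_denseSeq H).mono (Set.range_subset_iff.2 hq)

/-- If almost every fiber is surjective, then the fiberwise operator has dense range. -/
lemma denseRange_of_ae_surjective [CompleteSpace H]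
    (hS : ∀ f : Lp H 2 μ, ∀ᵐ q ∂μ, S f q = B q (f q))
    (hB : ∀ᵐ q ∂μ, Function.Surjective (B q)) : DenseRange S := by
  suffices h : S.range.topologicalClosure = ⊤ by
    rw [DenseRange, dense_iff_closure_eq]
    simpa [SetLike.ext'_iff] using! h
  rw [Submodule.topologicalClosure_eq_top_iff, Submodule.eq_bot_iff]
  intro g hg
  have hpt (v : H) : ∀ᵐ q ∂μ, inner ℂ (B q v) (g q) = 0 := by
    have hz : (fun q ↦ inner ℂ (S (Lp.const 2 μ v) q) (g q)) =ᵐ[μ] 0 := by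
      refine (L2.integrable_inner (S (Lp.const 2 μ v)) g).ae_eq_zero_of_forall_setIntegral_eq_zero
        fun s hs _ ↦ ?_
      have h0 := hg (S (indicatorConstLp 2 hs (measure_ne_top μ s) v)) ⟨_, rfl⟩
      rw [L2.inner_def] at h0
      rw [← h0, ← integral_indicator hs]
      refine integral_congr_ae ?_
      filter_upwards [fiberwise_indicatorConstLp_ae_eq hS hs v] with q hq
      rw [hq]
      by_cases hqs : q ∈ s <;> simp [hqs]
    filter_upwards [hz, hS (Lp.const 2 μ v), Lp.coeFn_const (p := 2) (μ := μ) (c := v)]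
      with q h₁ h₂ h₃
    rw [h₂, h₃] at h₁
    exact h₁
  have hall : ∀ᵐ q ∂μ, ∀ n, inner ℂ (B q (TopologicalSpace.denseSeq H n)) (g q) = 0 :=
    ae_all_iff.2 fun n ↦ hpt _
  rw [Lp.eq_zero_iff_ae_eq_zero]
  filter_upwards [hall, hB] with q hq hsurj
  obtain ⟨w, hw⟩ := hsurj (g q)
  have hzero : inner ℂ (B q w) (g q) = 0 := by
    refine (TopologicalSpace.denseRange_denseSeq H).induction_on
      (p := fun v ↦ inner ℂ (B q v) (g q) = 0) w ?_ hq
    exact isClosed_eq (by fun_prop) continuous_const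
  rw [hw] at hzero
  exact inner_self_eq_zero.1 hzero

/-- A fiberwise operator is invertible if and only if almost every fiber is invertible, with a
uniform bound on the inverses. -/
lemma isUnit_iff_exists_ae_norm_inverse_lt [CompleteSpace H]
    (hS : ∀ f : Lp H 2 μ, ∀ᵐ q ∂μ, S f q = B q (f q)) :
    IsUnit S ↔ ∃ ε : ℝ, 0 < ε ∧ ∀ᵐ q ∂μ, IsUnit (B q) ∧ ‖Ring.inverse (B q)‖ < 1 / ε := by
  constructor
  · intro h
    have hbelow := ae_forall_norm_le_of_fiberwise hS (K := ‖Ring.inverse S‖₊)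
      (ContinuousLinearMap.norm_le_norm_inverse_mul h)
    refine ⟨1 / (‖Ring.inverse S‖ + 1), by positivity, ?_⟩
    filter_upwards [hbelow, ae_denseRange_of_fiberwise hS
      (ContinuousLinearMap.isUnit_iff_bijective.1 h).2] with q hq hd
    have hu := ContinuousLinearMap.isUnit_of_bound_of_denseRange hq hd
    refine ⟨hu, ?_⟩
    rw [one_div_one_div]
    refine lt_of_le_of_lt ?_ (lt_add_one _)
    refine ContinuousLinearMap.opNorm_le_bound _ (norm_nonneg _) fun v ↦ ?_
    simpa only [ContinuousLinearMap.apply_inverse_apply hu] using! hq (Ring.inverse (B q) v)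
  · rintro ⟨ε, hε, h⟩
    refine ContinuousLinearMap.isUnit_of_bound_of_denseRange (K := ⟨1 / ε, by positivity⟩)
      (fun f ↦ ?_) (denseRange_of_ae_surjective hS ?_)
    · refine Lp.norm_le_mul_norm_of_ae_le_mul ?_
      filter_upwards [h, hS f] with q hq hf
      rw [hf]
      exact (ContinuousLinearMap.norm_le_norm_inverse_mul hq.1 _).trans
        (mul_le_mul_of_nonneg_right hq.2.le (norm_nonneg _))
    · filter_upwards [h] with q hq
      exact (ContinuousLinearMap.isUnit_iff_bijective.1 hq.1).2

end Fiberwise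

lemma notMem_pseudospectrum_iff {A : Type*} [NormedRing A] [NormedAlgebra ℂ A] {ε : ℝ} {B : A}
    {z : ℂ} : z ∉ pseudospectrum ε B ↔
      IsUnit (B - algebraMap ℂ A z) ∧ ‖Ring.inverse (B - algebraMap ℂ A z)‖ < 1 / ε := by
  rw [pseudospectrum, Set.mem_ofPred_eq, ← not_le]
  tauto

/-- Spectrum of a direct integral in terms of the pseudospectra of its fibers:
if `T` acts fiberwise on `L²([0,2π], H)` via a uniformly bounded measurable family
`q ↦ A q`, then `σ(T) ⊆ {λ : μ{q : λ ∈ σ_ε(A q)} > 0}` for every `ε > 0`, and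
`σ(T) = ⋂_{ε>0} {λ : μ{q : λ ∈ σ_ε(A q)} > 0}`. -/
theorem spectrum_directIntegral
    {H : Type*} [NormedAddCommGroup H] [InnerProductSpace ℂ H] [CompleteSpace H]
    [SecondCountableTopology H]
    (μ : Measure ℝ) (hμ : μ = volume.restrict (Set.Icc 0 (2 * π)))
    (A : ℝ → H →L[ℂ] H)
    (hbdd : ∃ C : ℝ, ∀ q ∈ Set.Icc (0 : ℝ) (2 * π), ‖A q‖ ≤ C)
    (hmeas : ∀ (z : ℂ) (ε : ℝ), 0 < ε →
      MeasurableSet {q ∈ Set.Icc (0 : ℝ) (2 * π) | z ∈ pseudospectrum ε (A q)})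
    (T : Lp H 2 μ →L[ℂ] Lp H 2 μ)
    (hT : ∀ f : Lp H 2 μ, ∀ᵐ q ∂μ, (T f : ℝ → H) q = A q (f q)) :
    (∀ ε : ℝ, 0 < ε → spectrum ℂ T ⊆
      {z : ℂ | 0 < μ {q ∈ Set.Icc (0 : ℝ) (2 * π) | z ∈ pseudospectrum ε (A q)}}) ∧
    spectrum ℂ T = ⋂ ε > (0 : ℝ),
      {z : ℂ | 0 < μ {q ∈ Set.Icc (0 : ℝ) (2 * π) | z ∈ pseudospectrum ε (A q)}} := by
  have hfin : IsFiniteMeasure μ := by rw [hμ]; infer_instance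
  have hmem : ∀ᵐ q ∂μ, q ∈ Set.Icc (0 : ℝ) (2 * π) := by
    rw [hμ]; exact ae_restrict_mem measurableSet_Icc
  have key (z : ℂ) : z ∈ spectrum ℂ T ↔ ∀ ε : ℝ, 0 < ε →
      0 < μ {q ∈ Set.Icc (0 : ℝ) (2 * π) | z ∈ pseudospectrum ε (A q)} := by
    have hS (f : Lp H 2 μ) : ∀ᵐ q ∂μ, (T - algebraMap ℂ _ z) f q
        = (A q - algebraMap ℂ (H →L[ℂ] H) z) (f q) := by
      filter_upwards [hT f, Lp.coeFn_sub (T f) (z • f), Lp.coeFn_smul z f] with q h₁ h₂ h₃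
      simp only [sub_apply, ContinuousLinearMap.algebraMap_apply]
      rw [h₂, Pi.sub_apply, h₁, h₃, Pi.smul_apply]
    rw [spectrum.mem_iff, IsUnit.sub_iff, isUnit_iff_exists_ae_norm_inverse_lt hS]
    rw [not_exists]
    refine forall_congr' fun ε ↦ ?_
    rw [not_and]
    refine imp_congr_right fun hε ↦ ?_
    rw [pos_iff_ne_zero, not_iff_not, measure_eq_zero_iff_ae_notMem]
    refine Filter.eventually_congr ?_
    filter_upwards [hmem] with q hq
    rw [← notMem_pseudospectrum_iff, not_and]
    exact ⟨fun h _ ↦ h, fun h ↦ h hq⟩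
  refine ⟨fun ε hε z hz ↦ (key z).1 hz ε hε, ?_⟩
  ext z
  simpa only [Set.mem_iInter] using! key z
end

section
/- Spectrum of a direct integral with norm-continuous fibers (Theorem 3.10): Let H be a complex Hilbert space, let μ be Lebesgue measure on the compact interval I = [0, 2π], and let A : I → B(H) be continuous with respect to the operator norm. Suppose T is a bounded operator on the Bochner space L²(I, H; μ) which acts fiberwise: for every f ∈ L²(I, H; μ), (T f)(q) = (A q)(f q) for μ-almost every q ∈ I. Then σ(T) = ⋃_{q∈I} σ(A q). -/
open MeasureTheory Real

section FiberwiseOperators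

variable {α H : Type*} [MeasurableSpace α] {μ : Measure α}
  [NormedAddCommGroup H] [InnerProductSpace ℂ H]

/-- Normalised constants on a set of positive finite measure embed `H` isometrically in
`L²(μ, H)`. -/
theorem exists_linearIsometry_indicator {s : Set α} (hs : MeasurableSet s) (hs0 : μ s ≠ 0)
    (hs_top : μ s ≠ ⊤) :
    ∃ (ι : H →ₗᵢ[ℂ] Lp H 2 μ) (c : ℂ), ∀ v, ι v =ᵐ[μ] s.indicator fun _ => c • v := by
  have hm : 0 < √(μ.real s) := Real.sqrt_pos.2 (ENNReal.toReal_pos hs0 hs_top)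
  let c : ℂ := ((√(μ.real s))⁻¹ : ℝ)
  refine ⟨⟨⟨⟨fun v => indicatorConstLp 2 hs hs_top (c • v), ?_⟩, ?_⟩, ?_⟩, c,
    fun v => indicatorConstLp_coeFn (hs := hs) (hμs := hs_top)⟩
  · intro v w
    rw [smul_add, indicatorConstLp_add]
  · intro a v
    simp only [RingHom.id_apply]
    rw [smul_comm, indicatorConstLp, indicatorConstLp, ← MemLp.toLp_const_smul]
    congr 1
    exact Set.indicator_const_smul s a fun _ => c • v
  · intro v
    change ‖indicatorConstLp 2 hs hs_top (c • v)‖ = ‖v‖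
    rw [norm_indicatorConstLp two_ne_zero ENNReal.ofNat_ne_top, norm_smul, ENNReal.toReal_ofNat,
      ← Real.sqrt_eq_rpow, Complex.norm_real, Real.norm_of_nonneg (inv_nonneg.2 hm.le)]
    field_simp

/-- A fiberwise operator almost commutes with an embedding of `H` as constants on a set where its
fibers are close to `B₀`. -/
theorem norm_comp_sub_fiberwise_comp_le {B : α → H →L[ℂ] H}
    {S : Lp H 2 μ →L[ℂ] Lp H 2 μ} (hS : ∀ f : Lp H 2 μ, ∀ᵐ q ∂μ, S f q = B q (f q))
    {s : Set α} {B₀ : H →L[ℂ] H} {ε : ℝ} (hε : 0 ≤ ε) (hB : ∀ q ∈ s, ‖B q - B₀‖ ≤ ε)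
    {ι : H →L[ℂ] Lp H 2 μ} (hι_norm : ‖ι‖ ≤ 1) {c : ℂ}
    (hι : ∀ v, ι v =ᵐ[μ] s.indicator fun _ => c • v) :
    ‖ι ∘L B₀ - S ∘L ι‖ ≤ ε := by
  refine ContinuousLinearMap.opNorm_le_bound _ hε fun v => ?_
  have hv : ‖ι v‖ ≤ ‖v‖ := by simpa using ι.le_of_opNorm_le hι_norm v
  refine le_trans ?_ (mul_le_mul_of_nonneg_left hv hε)
  change ‖ι (B₀ v) - S (ι v)‖ ≤ ε * ‖ι v‖
  refine Lp.norm_le_mul_norm_of_ae_le_mul ?_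
  filter_upwards [Lp.coeFn_sub (ι (B₀ v)) (S (ι v)), hι v, hι (B₀ v), hS (ι v)]
    with q h1 h2 h3 h4
  rw [h1, Pi.sub_apply, h4, h3, h2]
  by_cases hq : q ∈ s
  · simp only [Set.indicator_of_mem hq]
    rw [← map_smul, norm_sub_rev, ← sub_apply]
    exact (B q - B₀).le_of_opNorm_le (hB q hq) _
  · simp [Set.indicator_of_notMem hq]

/-- A fiberwise operator almost commutes with averaging over a set where its fibers are close
to `B₀`. -/
theorem norm_comp_adjoint_sub_adjoint_comp_fiberwise_le [CompleteSpace H] {B : α → H →L[ℂ] H}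
    {S : Lp H 2 μ →L[ℂ] Lp H 2 μ} (hS : ∀ f : Lp H 2 μ, ∀ᵐ q ∂μ, S f q = B q (f q))
    {s : Set α} (hs : MeasurableSet s) {B₀ : H →L[ℂ] H} {ε : ℝ} (hε : 0 ≤ ε)
    (hB : ∀ q ∈ s, ‖B q - B₀‖ ≤ ε)
    {ι : H →L[ℂ] Lp H 2 μ} (hι_norm : ‖ι‖ ≤ 1) {c : ℂ}
    (hι : ∀ v, ι v =ᵐ[μ] s.indicator fun _ => c • v) :
    ‖B₀ ∘L ContinuousLinearMap.adjoint ι - ContinuousLinearMap.adjoint ι ∘L S‖ ≤ ε := by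
  have hadj : ‖ContinuousLinearMap.adjoint ι‖ ≤ 1 := by
    rwa [LinearIsometryEquiv.norm_map]
  refine ContinuousLinearMap.opNorm_le_bound _ hε fun g => ?_
  obtain ⟨b, hb⟩ : ∃ b : Lp H 2 μ, ∀ᵐ q ∂μ, b q = B₀ (g q) :=
    ⟨B₀.compLp g, B₀.coeFn_compLp g⟩
  obtain ⟨k, hk⟩ : ∃ k : Lp H 2 μ,
      ∀ᵐ q ∂μ, k q = s.indicator (fun q => B₀ (g q) - B q (g q)) q := by
    have hmem : MemLp (s.indicator (b - S g : Lp H 2 μ)) 2 μ := (Lp.memLp (b - S g)).indicator hs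
    refine ⟨hmem.toLp _, ?_⟩
    filter_upwards [hmem.coeFn_toLp, Lp.coeFn_sub b (S g), hb, hS g] with q h1 h2 h3 h4
    rw [h1]
    by_cases hq : q ∈ s
    · rw [Set.indicator_of_mem hq, Set.indicator_of_mem hq, h2, Pi.sub_apply, h3, h4]
    · rw [Set.indicator_of_notMem hq, Set.indicator_of_notMem hq]
  have hk_norm : ‖k‖ ≤ ε * ‖g‖ := by
    refine Lp.norm_le_mul_norm_of_ae_le_mul ?_
    filter_upwards [hk] with q h
    rw [h]
    by_cases hq : q ∈ s
    · rw [Set.indicator_of_mem hq, norm_sub_rev, ← sub_apply]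
      exact (B q - B₀).le_of_opNorm_le (hB q hq) _
    · rw [Set.indicator_of_notMem hq, norm_zero]
      positivity
  have hB₀ : ∀ v, inner ℂ g (ι (ContinuousLinearMap.adjoint B₀ v)) = inner ℂ b (ι v) := by
    intro v
    rw [L2.inner_def, L2.inner_def]
    refine integral_congr_ae ?_
    filter_upwards [hι v, hι (ContinuousLinearMap.adjoint B₀ v), hb] with q h1 h2 h3
    rw [h1, h2, h3]
    by_cases hq : q ∈ s
    · rw [Set.indicator_of_mem hq, Set.indicator_of_mem hq, ← map_smul,
        ContinuousLinearMap.adjoint_inner_right]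
    · simp [Set.indicator_of_notMem hq]
  have hk_inner : ∀ v, inner ℂ (b - S g) (ι v) = inner ℂ k (ι v) := by
    intro v
    rw [L2.inner_def, L2.inner_def]
    refine integral_congr_ae ?_
    filter_upwards [hι v, hk, Lp.coeFn_sub b (S g), hb, hS g] with q h1 h2 h3 h4 h5
    rw [h1, h2, h3, Pi.sub_apply, h4, h5]
    by_cases hq : q ∈ s
    · simp only [Set.indicator_of_mem hq]
    · simp [Set.indicator_of_notMem hq]
  have heq : B₀ (ContinuousLinearMap.adjoint ι g) - ContinuousLinearMap.adjoint ι (S g)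
      = ContinuousLinearMap.adjoint ι k := by
    refine ext_inner_right ℂ fun v => ?_
    rw [inner_sub_left, ← ContinuousLinearMap.adjoint_inner_right,
      ContinuousLinearMap.adjoint_inner_left, ContinuousLinearMap.adjoint_inner_left,
      ContinuousLinearMap.adjoint_inner_left, hB₀, ← inner_sub_left, hk_inner]
  change ‖B₀ (ContinuousLinearMap.adjoint ι g) - ContinuousLinearMap.adjoint ι (S g)‖ ≤ _
  rw [heq]
  exact ((ContinuousLinearMap.adjoint ι).le_of_opNorm_le hadj k).trans (by rwa [one_mul])

/-- If a fiberwise operator is invertible and its fibers are close enough to `B₀` on a set of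
positive measure, then `B₀` is invertible. -/
theorem isUnit_of_fiberwise_of_norm_sub_le [CompleteSpace H] {B : α → H →L[ℂ] H}
    {S : Lp H 2 μ →L[ℂ] Lp H 2 μ} (hS : ∀ f : Lp H 2 μ, ∀ᵐ q ∂μ, S f q = B q (f q))
    (hunit : IsUnit S) {s : Set α} (hs : MeasurableSet s) (hs0 : μ s ≠ 0) (hs_top : μ s ≠ ⊤)
    {B₀ : H →L[ℂ] H} {ε : ℝ} (hε : 0 ≤ ε) (hB : ∀ q ∈ s, ‖B q - B₀‖ ≤ ε)
    (hsmall : ε * ‖Ring.inverse S‖ < 1) : IsUnit B₀ := by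
  obtain ⟨ι, c, hιn, hcomp, hι⟩ : ∃ (ι : H →L[ℂ] Lp H 2 μ) (c : ℂ), ‖ι‖ ≤ 1 ∧
      ContinuousLinearMap.adjoint ι ∘L ι = 1 ∧ ∀ v, ι v =ᵐ[μ] s.indicator fun _ => c • v := by
    obtain ⟨ι, c, hι⟩ := exists_linearIsometry_indicator (H := H) hs hs0 hs_top
    exact ⟨ι.toContinuousLinearMap, c, ι.norm_toContinuousLinearMap_le,
      (ContinuousLinearMap.norm_map_iff_adjoint_comp_self _).1 ι.norm_map, hι⟩
  have hadj : ‖ContinuousLinearMap.adjoint ι‖ ≤ 1 := by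
    rwa [LinearIsometryEquiv.norm_map]
  have hSR : S ∘L Ring.inverse S = 1 := Ring.mul_inverse_cancel S hunit
  have hRS : Ring.inverse S ∘L S = 1 := Ring.inverse_mul_cancel S hunit
  generalize Ring.inverse S = R at hSR hRS hsmall
  have hright := norm_comp_sub_fiberwise_comp_le hS hε hB hιn hι
  have hleft := norm_comp_adjoint_sub_adjoint_comp_fiberwise_le hS hs hε hB hιn hι
  have hunit_right : IsUnit (B₀ * (ContinuousLinearMap.adjoint ι ∘L R ∘L ι)) := by
    have hkey : B₀ * (ContinuousLinearMap.adjoint ι ∘L R ∘L ι)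
        = 1 - -((B₀.comp (ContinuousLinearMap.adjoint ι)
          - (ContinuousLinearMap.adjoint ι).comp S) ∘L R ∘L ι) := by
      ext v
      have h1 := congrArg (fun F => F (ι v)) hSR
      have h2 := congrArg (fun F => F v) hcomp
      simp only [ContinuousLinearMap.comp_apply, one_apply_eq_self] at h1 h2
      simp [h1, h2]
    rw [hkey]
    refine isUnit_one_sub_of_norm_lt_one ?_
    rw [norm_neg]
    refine lt_of_le_of_lt ?_ hsmall
    refine (ContinuousLinearMap.opNorm_comp_le _ _).trans ?_
    refine mul_le_mul hleft ?_ (norm_nonneg _) hε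
    exact (ContinuousLinearMap.opNorm_comp_le _ _).trans
      (mul_le_of_le_one_right (norm_nonneg _) hιn)
  have hunit_left : IsUnit ((ContinuousLinearMap.adjoint ι ∘L R ∘L ι) * B₀) := by
    have hkey : (ContinuousLinearMap.adjoint ι ∘L R ∘L ι) * B₀
        = 1 - -(ContinuousLinearMap.adjoint ι ∘L R ∘L (ι.comp B₀ - S.comp ι)) := by
      ext v
      have h1 := congrArg (fun F => F (ι v)) hRS
      have h2 := congrArg (fun F => F v) hcomp
      simp only [ContinuousLinearMap.comp_apply, one_apply_eq_self] at h1 h2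
      simp [h1, h2]
    rw [hkey]
    refine isUnit_one_sub_of_norm_lt_one ?_
    rw [norm_neg]
    refine lt_of_le_of_lt ?_ hsmall
    rw [mul_comm ε]
    refine (ContinuousLinearMap.opNorm_comp_le _ _).trans ?_
    refine (mul_le_of_le_one_left (norm_nonneg _) hadj).trans ?_
    refine (ContinuousLinearMap.opNorm_comp_le _ _).trans ?_
    exact mul_le_mul_of_nonneg_left hright (norm_nonneg _)
  rw [ContinuousLinearMap.isUnit_iff_bijective] at hunit_right hunit_left ⊢
  exact ⟨Function.Injective.of_comp (f := ContinuousLinearMap.adjoint ι ∘L R ∘L ι) hunit_left.1,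
    Function.Surjective.of_comp (g := ContinuousLinearMap.adjoint ι ∘L R ∘L ι) hunit_right.2⟩

/-- A fiberwise operator is invertible if its fibers have an essentially bounded measurable
family of inverses. -/
theorem isUnit_of_fiberwise_of_inverse [CompleteSpace H] {B D : α → H →L[ℂ] H}
    {S : Lp H 2 μ →L[ℂ] Lp H 2 μ} (hS : ∀ f : Lp H 2 μ, ∀ᵐ q ∂μ, S f q = B q (f q))
    (hD : AEStronglyMeasurable D μ) {C : ℝ} (hC : ∀ᵐ q ∂μ, ‖D q‖ ≤ C)
    (hBD : ∀ᵐ q ∂μ, B q * D q = 1) (hDB : ∀ᵐ q ∂μ, D q * B q = 1) : IsUnit S := by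
  rw [ContinuousLinearMap.isUnit_iff_bijective]
  constructor
  · rw [injective_iff_map_eq_zero]
    intro f hf
    rw [Lp.eq_zero_iff_ae_eq_zero]
    filter_upwards [hS f, hDB, Lp.coeFn_zero H 2 μ] with q h1 h2 h3
    rw [hf, h3] at h1
    have h4 := congrArg (fun F => F (f q)) h2
    simpa [← h1] using h4.symm
  · intro g
    have hmem : MemLp (fun q => D q (g q)) 2 μ := by
      refine (Lp.memLp g).of_le_mul (c := C) ?_ ?_
      · exact (ContinuousLinearMap.id ℂ (H →L[ℂ] H)).aestronglyMeasurable_comp₂ hD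
          (Lp.memLp g).aestronglyMeasurable
      · filter_upwards [hC] with q hq
        exact (D q).le_of_opNorm_le hq _
    refine ⟨hmem.toLp _, Lp.ext ?_⟩
    filter_upwards [hS (hmem.toLp _), hmem.coeFn_toLp, hBD] with q h1 h2 h3
    rw [h1, h2]
    exact congrArg (fun F => F (g q)) h3

end FiberwiseOperators

/-- Spectrum of a direct integral with norm-continuous fibers: if `T` acts fiberwise on
`L²([0,2π], H)` via a norm-continuous family `q ↦ A q` of bounded operators, then
`σ(T) = ⋃_{q ∈ [0,2π]} σ(A q)`. -/
theorem spectrum_directIntegral_of_continuous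
    {H : Type*} [NormedAddCommGroup H] [InnerProductSpace ℂ H] [CompleteSpace H]
    (μ : Measure ℝ) (hμ : μ = volume.restrict (Set.Icc 0 (2 * π)))
    (A : ℝ → H →L[ℂ] H)
    (hcont : ContinuousOn A (Set.Icc (0 : ℝ) (2 * π)))
    (T : Lp H 2 μ →L[ℂ] Lp H 2 μ)
    (hT : ∀ f : Lp H 2 μ, ∀ᵐ q ∂μ, (T f : ℝ → H) q = A q (f q)) :
    spectrum ℂ T = ⋃ q ∈ Set.Icc (0 : ℝ) (2 * π), spectrum ℂ (A q) := by
  have hfiber : ∀ (z : ℂ) (f : Lp H 2 μ), ∀ᵐ q ∂μ,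
      (algebraMap ℂ (Lp H 2 μ →L[ℂ] Lp H 2 μ) z - T) f q
        = (algebraMap ℂ (H →L[ℂ] H) z - A q) (f q) := by
    intro z f
    filter_upwards [hT f, Lp.coeFn_sub (z • f) (T f), Lp.coeFn_smul z f] with q h1 h2 h3
    change (z • f - T f : Lp H 2 μ) q = z • f q - A q (f q)
    rw [h2, Pi.sub_apply, h1, h3, Pi.smul_apply]
  have hcont' : ∀ z : ℂ, ContinuousOn (fun q => algebraMap ℂ (H →L[ℂ] H) z - A q)
      (Set.Icc (0 : ℝ) (2 * π)) := fun z => continuousOn_const.sub hcont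
  have hmem : ∀ᵐ q ∂μ, q ∈ Set.Icc (0 : ℝ) (2 * π) := by
    rw [hμ]
    exact ae_restrict_mem measurableSet_Icc
  ext z
  simp only [Set.mem_iUnion, exists_prop]
  constructor
  · intro hz
    by_contra! hres
    refine hz ?_
    have hunit : ∀ q ∈ Set.Icc (0 : ℝ) (2 * π), IsUnit (algebraMap ℂ (H →L[ℂ] H) z - A q) :=
      fun q hq => not_not.1 (hres q hq)
    have hD : ContinuousOn (fun q => Ring.inverse (algebraMap ℂ (H →L[ℂ] H) z - A q))
        (Set.Icc (0 : ℝ) (2 * π)) := by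
      intro q hq
      obtain ⟨u, hu⟩ := hunit q hq
      have hinv := NormedRing.inverse_continuousAt u
      rw [hu] at hinv
      exact hinv.comp_continuousWithinAt (f := fun q => algebraMap ℂ (H →L[ℂ] H) z - A q)
        (hcont' z q hq)
    obtain ⟨C, hC⟩ := isCompact_Icc.exists_bound_of_continuousOn hD
    refine isUnit_of_fiberwise_of_inverse (hfiber z) ?_ (hmem.mono hC)
      (hmem.mono fun q hq => Ring.mul_inverse_cancel _ (hunit q hq))
      (hmem.mono fun q hq => Ring.inverse_mul_cancel _ (hunit q hq))
    rw [hμ]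
    exact hD.aestronglyMeasurable measurableSet_Icc
  · rintro ⟨q₀, hq₀, hz⟩ hunit
    refine hz ?_
    change IsUnit (algebraMap ℂ (Lp H 2 μ →L[ℂ] Lp H 2 μ) z - T) at hunit
    set R := Ring.inverse (algebraMap ℂ (Lp H 2 μ →L[ℂ] Lp H 2 μ) z - T) with hR
    obtain ⟨δ, hδ, hclose⟩ := Metric.continuousOn_iff.1 (hcont' z) q₀ hq₀ (‖R‖ + 1)⁻¹
      (by positivity)
    have hpos : μ (Metric.ball q₀ δ ∩ Set.Ioo 0 (2 * π)) ≠ 0 := by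
      rw [hμ, Measure.restrict_eq_self _
        (Set.inter_subset_right.trans Set.Ioo_subset_Icc_self)]
      refine ((Metric.isOpen_ball.inter isOpen_Ioo).measure_pos volume ?_).ne'
      rw [← closure_Ioo (by positivity)] at hq₀
      exact mem_closure_iff.1 hq₀ _ Metric.isOpen_ball (Metric.mem_ball_self hδ)
    have hfin : μ (Metric.ball q₀ δ ∩ Set.Ioo 0 (2 * π)) ≠ ⊤ := by
      rw [hμ]
      exact measure_ne_top _ _
    refine isUnit_of_fiberwise_of_norm_sub_le (hfiber z) hunit
      (measurableSet_ball.inter measurableSet_Ioo) hpos hfin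
      (ε := (‖R‖ + 1)⁻¹) (by positivity) (fun q hq => ?_) ?_
    · have h := hclose q (Set.Ioo_subset_Icc_self hq.2) hq.1
      rw [dist_eq_norm] at h
      exact h.le
    · rw [← hR, inv_mul_lt_one₀ (by positivity)]
      exact lt_add_one _
end

section
/- Location of the roots of the symbol polynomial of an invertible family of tridiagonal Laurent operators (Lemma A.3): Let α, β, γ : ℝ → ℂ be continuous and 2π-periodic. Assume: (a) for every q ∈ [0, 2π) the tridiagonal Laurent operator T(q) = α(q)·S + β(q)·1 + γ(q)·S⁻¹ on ℓ²(ℤ) is invertible; (b) there is at most one q ∈ [0, 2π) with γ(q) = 0; (c) there exist q₀, q₁ ∈ [0, 2π) with |α(q₀)| ≥ |γ(q₀)| and |α(q₁)| ≤ |γ(q₁)|. Then for every q ∈ [0, 2π) with γ(q) ≠ 0, the quadratic polynomial γ(q)·x² + β(q)·x + α(q) has one root of modulus strictly less than 1 and one root of modulus strictly greater than 1. -/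
open Real

open Filter Topology

/-- A sequence on `ℤ` vanishing at infinity cannot satisfy `φ (n + 1) - z φ n = δ₀ n` with `z` on
the unit circle. -/
theorem not_tendsto_zero_of_recurrence {z : ℂ} (hz : ‖z‖ = 1) {φ : ℤ → ℂ}
    (hrec : ∀ n, n ≠ 0 → φ (n + 1) = z * φ n) (hone : φ 1 - z * φ 0 = 1) :
    ¬ Tendsto φ cofinite (𝓝 0) := by
  intro hφ
  have norm_step (n : ℤ) (hn : n ≠ 0) : ‖φ (n + 1)‖ = ‖φ n‖ := by
    rw [hrec n hn, norm_mul, hz, one_mul]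
  have eq_zero (e : ℕ → ℤ) (he : Function.Injective e) (c : ℂ)
      (hc : ∀ k, ‖φ (e k)‖ = ‖c‖) : c = 0 := by
    have hlim := (hφ.comp he.tendsto_cofinite).norm
    simp only [Function.comp_def, hc, norm_zero] at hlim
    exact norm_eq_zero.mp (tendsto_nhds_unique tendsto_const_nhds hlim)
  have h1 : φ 1 = 0 := by
    refine eq_zero (fun k => 1 + k) (fun a b h => by simpa using h) _ fun k => ?_
    induction k with
    | zero => simp
    | succ k ih =>
      rw [← ih, ← norm_step (1 + k) (by omega)]
      push_cast
      ring_nf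
  have h0 : φ 0 = 0 := by
    refine eq_zero (fun k => -k) (fun a b h => by simpa using h) _ fun k => ?_
    induction k with
    | zero => simp
    | succ k ih =>
      rw [← ih, ← norm_step (-((k + 1 : ℕ) : ℤ)) (by omega)]
      push_cast
      ring_nf
  simp [h0, h1] at hone

/-- The coordinates of a square-summable sequence vanish at infinity. -/
theorem lp_two_tendsto_zero (ψ : lp (fun _ : ℤ => ℂ) 2) :
    Tendsto (fun n => ψ n) cofinite (𝓝 0) := by
  have hs := ((lp.memℓp ψ).summable (by norm_num)).tendsto_cofinite_zero
  have hsqrt := hs.sqrt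
  simpa [Real.sqrt_sq, tendsto_zero_iff_norm_tendsto_zero] using hsqrt

/-- A surjective tridiagonal Laurent operator has a symbol polynomial without zeros on the unit
circle. -/
theorem symbol_ne_zero_of_surjective {a b c : ℂ}
    {T : lp (fun _ : ℤ => ℂ) 2 → lp (fun _ : ℤ => ℂ) 2}
    (hT : ∀ ψ n, T ψ n = a * ψ (n - 1) + b * ψ n + c * ψ (n + 1))
    (hsurj : Function.Surjective T) {z : ℂ} (hz : ‖z‖ = 1) :
    c * z ^ 2 + b * z + a ≠ 0 := by
  intro hroot
  obtain ⟨ψ, hψ⟩ := hsurj (lp.single 2 (0 : ℤ) (1 : ℂ))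
  have factor (n : ℤ) : c * ψ (n + 1) + (b + c * z) * ψ n
      - z * (c * ψ n + (b + c * z) * ψ (n - 1))
      = (lp.single 2 (0 : ℤ) (1 : ℂ) : lp (fun _ : ℤ => ℂ) 2) n := by
    rw [← hψ, hT]
    linear_combination (-ψ (n - 1)) * hroot
  refine not_tendsto_zero_of_recurrence hz (φ := fun n => c * ψ n + (b + c * z) * ψ (n - 1))
    (fun n hn => ?_) ?_ ?_
  · have h := factor n
    rw [lp.single_apply_ne _ _ _ hn] at h
    simpa using sub_eq_zero.mp h
  · have h := factor 0
    rw [lp.single_apply_self] at h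
    simpa using h
  · have hψ0 := lp_two_tendsto_zero ψ
    have hshift := hψ0.comp (sub_left_injective (b := (1 : ℤ))).tendsto_cofinite
    simpa using (hψ0.const_mul c).add (hshift.const_mul (b + c * z))

/-- For `c ≠ 0` this is `‖c‖² (1 - ‖x‖²) (1 - ‖y‖²)`, where `x` and `y` are the roots of
`c X² + b X + a`; it is continuous in the coefficients even where `c` vanishes. -/
noncomputable def circleDiscriminant (a b c : ℂ) : ℝ :=
  ‖a‖ ^ 2 + ‖c‖ ^ 2 - (‖b‖ ^ 2 + ‖b ^ 2 - 4 * a * c‖) / 2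

theorem circleDiscriminant_eq (c x y : ℂ) :
    circleDiscriminant (c * (x * y)) (-(c * (x + y))) c
      = ‖c‖ ^ 2 * ((1 - ‖x‖ ^ 2) * (1 - ‖y‖ ^ 2)) := by
  have hdisc : (-(c * (x + y))) ^ 2 - 4 * (c * (x * y)) * c = (c * (x - y)) ^ 2 := by ring
  have hpar := parallelogram_law_with_norm ℝ x y
  rw [circleDiscriminant, hdisc]
  simp only [norm_neg, norm_mul, norm_pow]
  linear_combination (-‖c‖ ^ 2 / 2) * hpar

theorem exists_roots_of_ne_zero (a b : ℂ) {c : ℂ} (hc : c ≠ 0) :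
    ∃ x y : ℂ, a = c * (x * y) ∧ b = -(c * (x + y)) := by
  obtain ⟨s, hs⟩ := IsAlgClosed.exists_pow_nat_eq (b ^ 2 - 4 * a * c) two_pos
  refine ⟨(-b + s) / (2 * c), (-b - s) / (2 * c), ?_, ?_⟩
  · field_simp
    linear_combination hs
  · field_simp
    ring

theorem circleDiscriminant_ne_zero {a b c : ℂ}
    (h : ∀ z : ℂ, ‖z‖ = 1 → c * z ^ 2 + b * z + a ≠ 0) : circleDiscriminant a b c ≠ 0 := by
  intro hD
  by_cases hc : c = 0
  · subst hc
    have hab : ‖a‖ = ‖b‖ := by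
      rw [← sq_eq_sq₀ (norm_nonneg _) (norm_nonneg _)]
      simp only [circleDiscriminant, mul_zero, sub_zero, norm_pow, norm_zero] at hD
      linarith
    by_cases hb : b = 0
    · have ha : a = 0 := by simpa [hb] using hab
      exact h 1 norm_one (by simp [ha, hb])
    · refine h (-(a / b)) ?_ (by field_simp; ring)
      rw [norm_neg, norm_div, hab, div_self (norm_ne_zero_iff.mpr hb)]
  · obtain ⟨x, y, rfl, rfl⟩ := exists_roots_of_ne_zero a b hc
    rw [circleDiscriminant_eq] at hD
    have norm_one_of (w : ℂ) (hw : 1 - ‖w‖ ^ 2 = 0) : ‖w‖ = 1 := by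
      nlinarith [norm_nonneg w]
    rcases mul_eq_zero.mp ((mul_eq_zero.mp hD).resolve_left (by simpa using hc)) with hx | hy
    · exact h x (norm_one_of x hx) (by ring)
    · exact h y (norm_one_of y hy) (by ring)

theorem circleDiscriminant_nonpos {a b c : ℂ} (h : ‖a‖ = ‖c‖) :
    circleDiscriminant a b c ≤ 0 := by
  have htri : ‖4 * a * c‖ ≤ ‖b ^ 2‖ + ‖b ^ 2 - 4 * a * c‖ := by
    calc ‖4 * a * c‖ = ‖b ^ 2 - (b ^ 2 - 4 * a * c)‖ := by congr 1; ring
      _ ≤ _ := norm_sub_le _ _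
  simp only [norm_mul, norm_pow, h, Complex.norm_ofNat] at htri
  rw [circleDiscriminant, h]
  linarith

theorem exists_roots_of_circleDiscriminant_neg {a b c : ℂ} (hc : c ≠ 0)
    (hD : circleDiscriminant a b c < 0) :
    ∃ x y : ℂ, c * x ^ 2 + b * x + a = 0 ∧ c * y ^ 2 + b * y + a = 0 ∧ ‖x‖ < 1 ∧ 1 < ‖y‖ := by
  obtain ⟨x, y, rfl, rfl⟩ := exists_roots_of_ne_zero a b hc
  rw [circleDiscriminant_eq] at hD
  have hprod : (1 - ‖x‖ ^ 2) * (1 - ‖y‖ ^ 2) < 0 := by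
    by_contra! hnonneg
    exact hD.not_ge (by positivity)
  rcases mul_neg_iff.mp hprod with ⟨h1, h2⟩ | ⟨h1, h2⟩
  · exact ⟨x, y, by ring, by ring, by nlinarith [norm_nonneg x], by nlinarith [norm_nonneg y]⟩
  · exact ⟨y, x, by ring, by ring, by nlinarith [norm_nonneg y], by nlinarith [norm_nonneg x]⟩

/-- Location of the roots of the symbol polynomial of an invertible family of tridiagonal
Laurent operators: if `T(q) = α(q)S + β(q) + γ(q)S⁻¹` is invertible for every
`q ∈ [0,2π)`, `γ` vanishes at most once on `[0,2π)`, and `|α| ≥ |γ|` at some point while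
`|α| ≤ |γ|` at another, then for every `q ∈ [0,2π)` with `γ(q) ≠ 0` the quadratic
`γ(q)x² + β(q)x + α(q)` has one root of modulus `< 1` and one of modulus `> 1`. -/
theorem tridiagonal_symbol_roots
    (α β γ : ℝ → ℂ)
    (hαc : Continuous α) (hβc : Continuous β) (hγc : Continuous γ)
    (hαp : Function.Periodic α (2 * π)) (hβp : Function.Periodic β (2 * π))
    (hγp : Function.Periodic γ (2 * π))
    (T : ℝ → (lp (fun _ : ℤ => ℂ) 2 →L[ℂ] lp (fun _ : ℤ => ℂ) 2))
    (hT : ∀ (q : ℝ) (ψ : lp (fun _ : ℤ => ℂ) 2) (n : ℤ),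
      T q ψ n = α q * ψ (n - 1) + β q * ψ n + γ q * ψ (n + 1))
    (hinv : ∀ q ∈ Set.Ico (0 : ℝ) (2 * π), IsUnit (T q))
    (hγ0 : {q ∈ Set.Ico (0 : ℝ) (2 * π) | γ q = 0}.Subsingleton)
    (q₀ : ℝ) (hq₀ : q₀ ∈ Set.Ico (0 : ℝ) (2 * π)) (h₀ : ‖γ q₀‖ ≤ ‖α q₀‖)
    (q₁ : ℝ) (hq₁ : q₁ ∈ Set.Ico (0 : ℝ) (2 * π)) (h₁ : ‖α q₁‖ ≤ ‖γ q₁‖) :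
    ∀ q ∈ Set.Ico (0 : ℝ) (2 * π), γ q ≠ 0 →
      ∃ x y : ℂ, γ q * x ^ 2 + β q * x + α q = 0 ∧ γ q * y ^ 2 + β q * y + α q = 0 ∧
        ‖x‖ < 1 ∧ 1 < ‖y‖ := by
  intro q hq hγq
  refine exists_roots_of_circleDiscriminant_neg hγq ?_
  have hne (t : ℝ) (ht : t ∈ Set.Ico (0 : ℝ) (2 * π)) :
      circleDiscriminant (α t) (β t) (γ t) ≠ 0 :=
    circleDiscriminant_ne_zero fun z hz => symbol_ne_zero_of_surjective (hT t)
      (ContinuousLinearMap.isUnit_iff_bijective.mp (hinv t ht)).2 hz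
  have hcont : Continuous fun t => circleDiscriminant (α t) (β t) (γ t) := by
    unfold circleDiscriminant
    fun_prop
  obtain ⟨p, hp, hpeq⟩ := isPreconnected_Ico.intermediate_value₂ hq₁ hq₀
    hαc.norm.continuousOn hγc.norm.continuousOn h₁ h₀
  by_contra! hpos
  obtain ⟨t, ht, ht0⟩ := isPreconnected_Ico.intermediate_value hp hq hcont.continuousOn
    ⟨circleDiscriminant_nonpos hpeq, hpos⟩
  exact hne t ht ht0
end

section
/- Approximate point spectrum dominates the Laurent part under finite-range perturbations (core of Theorem 4.1): Let r ∈ ℕ, a_{−r}, …, a_r ∈ ℂ, and let T = Σ_{j=−r}^{r} a_j·S^{−j} be the associated banded Laurent operator on ℓ²(ℤ). Let F be a bounded operator on ℓ²(ℤ) of finite range: there exists R ∈ ℕ such that F = P F P, where P is the orthogonal projection onto span{e_x : |x| ≤ R}. Then σ(T) ⊆ σ_appt(T + F); in particular (taking F = 0), every banded Laurent operator T satisfies σ(T) = σ_appt(T). -/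
/-- The approximate point spectrum of a bounded operator: the set of `z ∈ ℂ` admitting a
sequence of unit vectors `ψₘ` with `‖(B - z)ψₘ‖ → 0`. -/
def approxPointSpectrum {H : Type*} [NormedAddCommGroup H] [NormedSpace ℂ H]
    (B : H →L[ℂ] H) : Set ℂ :=
  {z : ℂ | ∃ ψ : ℕ → H, (∀ m, ‖ψ m‖ = 1) ∧
    Filter.Tendsto (fun m => ‖B (ψ m) - z • ψ m‖) Filter.atTop (nhds 0)}

open Filter Topology Polynomial

/-- The Hilbert space `ℓ²(ℤ)`. -/
local notation "ℓ²ℤ" => lp (fun _ : ℤ => ℂ) 2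

/-- Points of the approximate point spectrum belong to the spectrum. -/
theorem approxPointSpectrum_subset_spectrum {H : Type*} [NormedAddCommGroup H] [NormedSpace ℂ H]
    (B : H →L[ℂ] H) : approxPointSpectrum B ⊆ spectrum ℂ B := by
  rintro z ⟨ψ, hψ, hlim⟩ hz
  obtain ⟨G, hG⟩ := hz.exists_left_inv
  have bound : ∀ m, 1 ≤ ‖G‖ * ‖B (ψ m) - z • ψ m‖ := fun m => by
    have hinv : G (z • ψ m - B (ψ m)) = ψ m := by
      simpa using congrArg (fun A : H →L[ℂ] H => A (ψ m)) hG
    calc 1 = ‖G (z • ψ m - B (ψ m))‖ := by rw [hinv, hψ]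
      _ ≤ ‖G‖ * ‖z • ψ m - B (ψ m)‖ := G.le_opNorm _
      _ = ‖G‖ * ‖B (ψ m) - z • ψ m‖ := by rw [norm_sub_rev]
  have hzero := hlim.const_mul ‖G‖
  rw [mul_zero] at hzero
  exact absurd (ge_of_tendsto' hzero bound) (by norm_num)

theorem memℓp_comp_equiv (e : ℤ ≃ ℤ) (ψ : ℓ²ℤ) : Memℓp (fun n => ψ (e n)) 2 := by
  have h := (memℓp_gen_iff (by norm_num)).1 (lp.memℓp ψ)
  exact (memℓp_gen_iff (by norm_num)).2 (e.summable_iff.2 h)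

/-- The backward shift `(Uψ)(n) = ψ(n + 1)` as a linear isometric automorphism of `ℓ²(ℤ)`. -/
noncomputable def backwardShift : ℓ²ℤ ≃ₗᵢ[ℂ] ℓ²ℤ where
  toFun ψ := ⟨fun n => ψ (n + 1), memℓp_comp_equiv (Equiv.addRight 1) ψ⟩
  invFun ψ := ⟨fun n => ψ (n - 1), memℓp_comp_equiv (Equiv.subRight 1) ψ⟩
  left_inv ψ := by ext n; simp
  right_inv ψ := by ext n; simp
  map_add' ψ φ := by ext n; rfl
  map_smul' c ψ := by ext n; simp
  norm_map' ψ := by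
    rw [lp.norm_eq_tsum_rpow (by norm_num), lp.norm_eq_tsum_rpow (by norm_num)]
    exact congrArg (· ^ _)
      ((Equiv.addRight (1 : ℤ)).tsum_eq fun n => ‖ψ n‖ ^ (2 : ENNReal).toReal)

/-- The backward shift as an element of the algebra of bounded operators. -/
noncomputable def shiftOp : ℓ²ℤ →L[ℂ] ℓ²ℤ := backwardShift.toContinuousLinearEquiv

@[simp]
theorem shiftOp_apply (ψ : ℓ²ℤ) (n : ℤ) : shiftOp ψ n = ψ (n + 1) := rfl

theorem norm_shiftOp_apply (ψ : ℓ²ℤ) : ‖shiftOp ψ‖ = ‖ψ‖ := backwardShift.norm_map ψ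

theorem shiftOp_mem_unitary : shiftOp ∈ unitary (ℓ²ℤ →L[ℂ] ℓ²ℤ) :=
  (Unitary.linearIsometryEquiv.symm backwardShift).2

theorem shiftOp_pow_apply (k : ℕ) (ψ : ℓ²ℤ) (n : ℤ) : (shiftOp ^ k) ψ n = ψ (n + k) := by
  induction k generalizing n with
  | zero => simp
  | succ k ih =>
    rw [pow_succ', mul_apply_eq_comp, shiftOp_apply, ih]
    push_cast
    ring_nf

theorem norm_shiftOp_pow_apply (k : ℕ) (ψ : ℓ²ℤ) : ‖(shiftOp ^ k) ψ‖ = ‖ψ‖ := by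
  induction k with
  | zero => simp
  | succ k ih => rw [pow_succ', mul_apply_eq_comp, norm_shiftOp_apply, ih]

theorem shiftOp_single (x : ℤ) (c : ℂ) :
    shiftOp (lp.single 2 x c) = lp.single 2 (x - 1) c := by
  ext n
  simp [lp.single_apply, Pi.single_apply, eq_sub_iff_add_eq]

/-- The polynomial `∑ⱼ aⱼ X^{j + r} - z X^r`, which evaluates at the backward shift to
`U^r (T - z)`. -/
noncomputable def laurentPoly (r : ℕ) (a : ℤ → ℂ) (z : ℂ) : ℂ[X] :=
  ∑ j ∈ Finset.Icc (-(r : ℤ)) (r : ℤ), C (a j) * X ^ (j + r).toNat - C z * X ^ r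

theorem aeval_laurentPoly (r : ℕ) (a : ℤ → ℂ) (T : ℓ²ℤ →L[ℂ] ℓ²ℤ)
    (hT : ∀ (ψ : ℓ²ℤ) (n : ℤ), T ψ n = ∑ j ∈ Finset.Icc (-(r : ℤ)) (r : ℤ), a j * ψ (n + j))
    (z : ℂ) :
    aeval shiftOp (laurentPoly r a z) =
      shiftOp ^ r * (T - algebraMap ℂ (ℓ²ℤ →L[ℂ] ℓ²ℤ) z) := by
  ext ψ n
  simp only [laurentPoly, map_sub, map_sum, map_mul, aeval_C, map_pow, aeval_X,
    _root_.sub_apply, _root_.sum_apply, mul_apply_eq_comp,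
    ContinuousLinearMap.algebraMap_apply, lp.coeFn_sub, lp.coeFn_sum, Pi.sub_apply,
    Finset.sum_apply, lp.coeFn_smul, Pi.smul_apply, shiftOp_pow_apply, hT, smul_eq_mul]
  congr 1
  refine Finset.sum_congr rfl fun j hj => ?_
  rw [Finset.mem_Icc] at hj
  rw [Int.toNat_of_nonneg (by omega)]
  ring_nf

/-- A spectral value of a banded Laurent operator is attained by its symbol on the unit circle. -/
theorem exists_root_laurentPoly_of_mem_spectrum (r : ℕ) (a : ℤ → ℂ) (T : ℓ²ℤ →L[ℂ] ℓ²ℤ)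
    (hT : ∀ (ψ : ℓ²ℤ) (n : ℤ), T ψ n = ∑ j ∈ Finset.Icc (-(r : ℤ)) (r : ℤ), a j * ψ (n + j))
    {z : ℂ} (hz : z ∈ spectrum ℂ T) :
    ∃ u : ℂ, ‖u‖ = 1 ∧ (laurentPoly r a z).IsRoot u := by
  have hU : IsUnit (shiftOp ^ r) :=
    (Unitary.toUnits ⟨shiftOp, shiftOp_mem_unitary⟩).isUnit.pow r
  have hnot : (0 : ℂ) ∈ spectrum ℂ (aeval shiftOp (laurentPoly r a z)) := by
    rw [spectrum.zero_mem_iff, aeval_laurentPoly r a T hT, hU.mul_left_iff, ← IsUnit.neg_iff,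
      neg_sub]
    exact hz
  have : Nontrivial ℓ²ℤ := by
    refine ⟨lp.single 2 0 1, 0, fun h => ?_⟩
    simpa using congrArg (fun ψ : ℓ²ℤ => ψ 0) h
  rw [spectrum.map_polynomial_aeval] at hnot
  obtain ⟨u, hu, hroot⟩ := hnot
  exact ⟨u, by simpa using spectrum.subset_circle_of_unitary shiftOp_mem_unitary hu, hroot⟩

/-- The plane wave with multiplier `u`, truncated to the window `[M, M + N)`. -/
noncomputable def truncatedWave (u : ℂ) (M : ℤ) (N : ℕ) : ℓ²ℤ :=
  ∑ k ∈ Finset.range N, lp.single 2 (M + k) (u ^ k)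

theorem truncatedWave_apply_eq_zero (u : ℂ) {M n : ℤ} (N : ℕ) (hn : n < M) :
    truncatedWave u M N n = 0 := by
  rw [truncatedWave, lp.coeFn_sum, Finset.sum_apply]
  exact Finset.sum_eq_zero fun k _ => lp.single_apply_ne _ _ _ (by omega)

theorem norm_truncatedWave {u : ℂ} (hu : ‖u‖ = 1) (M : ℤ) (N : ℕ) :
    ‖truncatedWave u M N‖ = √N := by
  let e : ℕ ↪ ℤ := ⟨fun k => M + k, fun _ _ h => by simpa using h⟩
  have he : ∀ k, e k = M + k := fun _ => rfl
  have h := lp.norm_sum_single (E := fun _ : ℤ => ℂ) (p := 2) (by norm_num)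
    (fun n => u ^ (n - M).toNat) ((Finset.range N).map e)
  rw [Finset.sum_map, Finset.sum_map] at h
  simp only [he, add_sub_cancel_left, Int.toNat_natCast, norm_pow, hu, one_pow, Finset.sum_const,
    Finset.card_range, nsmul_eq_mul, mul_one, ENNReal.toReal_ofNat, Real.rpow_ofNat] at h
  rw [← h, Real.sqrt_sq (norm_nonneg _), truncatedWave]

theorem norm_shiftOp_truncatedWave_sub_le {u : ℂ} (hu : ‖u‖ = 1) (M : ℤ) (N : ℕ) :
    ‖shiftOp (truncatedWave u M N) - u • truncatedWave u M N‖ ≤ 2 := by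
  set g : ℕ → ℓ²ℤ := fun k => lp.single 2 (M + k - 1) (u ^ k) with hg
  have hnorm : ∀ k, ‖g k‖ = 1 := fun k => by
    rw [hg, lp.norm_single (by norm_num), norm_pow, hu, one_pow]
  have htel : shiftOp (truncatedWave u M N) - u • truncatedWave u M N = g 0 - g N := by
    rw [← Finset.sum_range_sub', truncatedWave, map_sum, Finset.smul_sum,
      ← Finset.sum_sub_distrib]
    refine Finset.sum_congr rfl fun k _ => ?_
    rw [shiftOp_single, ← lp.single_smul, smul_eq_mul, ← pow_succ', hg]
    simp only [Nat.cast_add, Nat.cast_one, ← add_assoc, add_sub_cancel_right]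
  rw [htel]
  exact (norm_sub_le _ _).trans (by rw [hnorm, hnorm]; norm_num)

theorem exists_bound_truncatedWave (r : ℕ) (a : ℤ → ℂ) (T : ℓ²ℤ →L[ℂ] ℓ²ℤ)
    (hT : ∀ (ψ : ℓ²ℤ) (n : ℤ), T ψ n = ∑ j ∈ Finset.Icc (-(r : ℤ)) (r : ℤ), a j * ψ (n + j))
    {z u : ℂ} (hu : ‖u‖ = 1) (hroot : (laurentPoly r a z).IsRoot u) :
    ∃ K : ℝ, ∀ (M : ℤ) (N : ℕ),
      ‖T (truncatedWave u M N) - z • truncatedWave u M N‖ ≤ K := by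
  obtain ⟨q, hq⟩ := dvd_iff_isRoot.2 hroot
  refine ⟨‖aeval shiftOp q‖ * 2, fun M N => ?_⟩
  set φ := truncatedWave u M N
  have hfactor : (shiftOp ^ r) (T φ - z • φ) = aeval shiftOp q (shiftOp φ - u • φ) := by
    have h := aeval_laurentPoly r a T hT z
    rw [hq, mul_comm, map_mul] at h
    simpa using (congrArg (fun A : ℓ²ℤ →L[ℂ] ℓ²ℤ => A φ) h).symm
  rw [← norm_shiftOp_pow_apply r, hfactor]
  exact ((aeval shiftOp q).le_opNorm _).trans
    (by gcongr; exact norm_shiftOp_truncatedWave_sub_le hu M N)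

theorem laurent_spectrum_subset_approxPointSpectrum_add (r : ℕ) (a : ℤ → ℂ)
    (T : ℓ²ℤ →L[ℂ] ℓ²ℤ)
    (hT : ∀ (ψ : ℓ²ℤ) (n : ℤ), T ψ n = ∑ j ∈ Finset.Icc (-(r : ℤ)) (r : ℤ), a j * ψ (n + j))
    (F : ℓ²ℤ →L[ℂ] ℓ²ℤ) (R : ℕ)
    (hF : ∀ ψ : ℓ²ℤ, (∀ n : ℤ, |n| ≤ (R : ℤ) → ψ n = 0) → F ψ = 0) :
    spectrum ℂ T ⊆ approxPointSpectrum (T + F) := by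
  intro z hz
  obtain ⟨u, hu, hroot⟩ := exists_root_laurentPoly_of_mem_spectrum r a T hT hz
  obtain ⟨K, hK⟩ := exists_bound_truncatedWave r a T hT hu hroot
  set φ : ℕ → ℓ²ℤ := fun m => truncatedWave u (R + 1) (m + 1)
  have hFφ : ∀ m, F (φ m) = 0 := fun m => hF _ fun n hn =>
    truncatedWave_apply_eq_zero u _ (by have := le_abs_self n; omega)
  set c : ℕ → ℝ := fun m => (√((m + 1 : ℕ) : ℝ))⁻¹
  have hc : ∀ m, 0 ≤ c m := fun m => by positivity
  have hcnorm : ∀ m, ‖(c m : ℂ)‖ = c m := fun m => by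
    rw [Complex.norm_real, Real.norm_of_nonneg (hc m)]
  have hclim : Tendsto c atTop (𝓝 0) :=
    tendsto_inv_atTop_zero.comp (Real.tendsto_sqrt_atTop.comp
      (tendsto_natCast_atTop_atTop.comp (tendsto_add_atTop_nat 1)))
  refine ⟨fun m => (c m : ℂ) • φ m, fun m => ?_, ?_⟩
  · rw [norm_smul, hcnorm, norm_truncatedWave hu]
    exact inv_mul_cancel₀ (by positivity)
  · refine squeeze_zero (fun _ => norm_nonneg _) (fun m => ?_)
      (by simpa using hclim.mul_const K)
    have hsplit : (T + F) ((c m : ℂ) • φ m) - z • (c m : ℂ) • φ m =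
        (c m : ℂ) • (T (φ m) - z • φ m) := by
      rw [map_smul, _root_.add_apply, hFφ, add_zero, smul_comm z, smul_sub]
    rw [hsplit, norm_smul, hcnorm]
    exact mul_le_mul_of_nonneg_left (hK _ _) (hc m)

/-- The spectrum of a banded Laurent operator `T = ∑_{j=-r}^{r} aⱼ S^{-j}` on `ℓ²(ℤ)` is
contained in the approximate point spectrum of `T + F` for any finite-range perturbation `F`
(`F = PFP` with `P` the projection onto `span{eₓ : |x| ≤ R}`); in particular
`σ(T) = σ_appt(T)`. -/
theorem laurent_spectrum_subset_approxPoint (r : ℕ) (a : ℤ → ℂ)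
    (T : lp (fun _ : ℤ => ℂ) 2 →L[ℂ] lp (fun _ : ℤ => ℂ) 2)
    (hT : ∀ (ψ : lp (fun _ : ℤ => ℂ) 2) (n : ℤ),
      T ψ n = ∑ j ∈ Finset.Icc (-(r : ℤ)) (r : ℤ), a j * ψ (n + j))
    (F : lp (fun _ : ℤ => ℂ) 2 →L[ℂ] lp (fun _ : ℤ => ℂ) 2)
    (hF : ∃ R : ℕ,
      (∀ (ψ : lp (fun _ : ℤ => ℂ) 2) (n : ℤ), (R : ℤ) < |n| → F ψ n = 0) ∧
      (∀ ψ : lp (fun _ : ℤ => ℂ) 2, (∀ n : ℤ, |n| ≤ (R : ℤ) → ψ n = 0) → F ψ = 0)) :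
    spectrum ℂ T ⊆ approxPointSpectrum (T + F) ∧
      spectrum ℂ T = approxPointSpectrum T := by
  obtain ⟨R, -, hR⟩ := hF
  refine ⟨laurent_spectrum_subset_approxPointSpectrum_add r a T hT F R hR,
    Set.Subset.antisymm ?_ (approxPointSpectrum_subset_spectrum T)⟩
  simpa using laurent_spectrum_subset_approxPointSpectrum_add r a T hT 0 0 fun _ _ => rfl
end

section
/- Spectrum of the non-Hermitian evolution for local dephasing (Proposition 5.1): Let G > 0 and let 𝒯 be the bounded operator on ℓ²(ℤ×ℤ) defined by (𝒯ψ)(x,y) = i·(ψ(x+1,y) + ψ(x−1,y) − ψ(x,y+1) − ψ(x,y−1)) − G·ψ(x,y) for all ψ ∈ ℓ²(ℤ×ℤ) and (x,y) ∈ ℤ×ℤ. (This is the vectorization of the non-Hermitian evolution ρ ↦ −i(H_eff ρ − ρ H_eff*) on Hilbert–Schmidt operators, for Hamiltonian H = −(S + S*) and Lindblad operators L_k = |e_k⟩⟨e_k|.) Then σ(𝒯) = { −G + i·t : t ∈ ℝ, −4 ≤ t ≤ 4 }. -/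
open scoped ENNReal

/-- Reindexing along a permutation of the index type, as an isometry of `ℓ²`. -/
noncomputable def lpReindex {α : Type*} (e : α ≃ α) :
    lp (fun _ : α => ℂ) 2 ≃ₗᵢ[ℂ] lp (fun _ : α => ℂ) 2 where
  toFun f := ⟨fun i => f (e i), memℓp_gen (e.summable_iff.2 ((lp.memℓp f).summable (by simp)))⟩
  invFun f :=
    ⟨fun i => f (e.symm i), memℓp_gen (e.symm.summable_iff.2 ((lp.memℓp f).summable (by simp)))⟩
  map_add' f g := by ext i; rfl
  map_smul' c f := by ext i; rfl
  left_inv f := by ext i; simp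
  right_inv f := by ext i; simp
  norm_map' f := by
    have hp : 0 < (2 : ℝ≥0∞).toReal := by simp
    rw [lp.norm_eq_tsum_rpow hp, lp.norm_eq_tsum_rpow hp]
    congr 1
    exact e.tsum_eq fun i => ‖f i‖ ^ (2 : ℝ≥0∞).toReal

/-- A pointwise bound of `f` by a multiple of `g` gives the same bound of the `ℓ²` norms. -/
lemma lp_norm_le_mul_of_forall_le {α : Type*} {f g : lp (fun _ : α => ℂ) 2} {c : ℝ} (hc : 0 ≤ c)
    (h : ∀ i, ‖f i‖ ≤ c * ‖g i‖) : ‖f‖ ≤ c * ‖g‖ := by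
  have hfg : ∀ i, ‖f i‖ ≤ ‖((c : ℂ) • g) i‖ := fun i => by
    rw [lp.coeFn_smul, Pi.smul_apply, norm_smul, Complex.norm_of_nonneg hc]
    exact h i
  have := lp.norm_mono (p := 2) (by simp) hfg
  rwa [norm_smul, Complex.norm_of_nonneg hc] at this

/-- An operator with arbitrarily good approximate null vectors is not invertible. -/
lemma not_isUnit_of_approx_null {E : Type*} [NormedAddCommGroup E] [NormedSpace ℂ E]
    (S : E →L[ℂ] E) (h : ∀ ε > 0, ∃ v : E, v ≠ 0 ∧ ‖S v‖ ≤ ε * ‖v‖) : ¬ IsUnit S := by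
  rintro ⟨u, rfl⟩
  set R : E →L[ℂ] E := (↑u⁻¹ : E →L[ℂ] E)
  obtain ⟨v, hv, hle⟩ := h (1 / (‖R‖ + 1)) (by positivity)
  have hRv : R ((u : E →L[ℂ] E) v) = v := by
    change ((↑u⁻¹ : E →L[ℂ] E) * u) v = v
    simp
  have hv' : 0 < ‖v‖ := norm_pos_iff.2 hv
  have h1 : ‖v‖ ≤ ‖R‖ * (1 / (‖R‖ + 1) * ‖v‖) :=
    calc ‖v‖ = ‖R ((u : E →L[ℂ] E) v)‖ := by rw [hRv]
      _ ≤ ‖R‖ * ‖(u : E →L[ℂ] E) v‖ := R.le_opNorm _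
      _ ≤ _ := by gcongr
  have h2 : ‖R‖ * (1 / (‖R‖ + 1) * ‖v‖) < ‖v‖ := by
    have : ‖R‖ / (‖R‖ + 1) < 1 := by
      rw [div_lt_one (by positivity)]; linarith
    calc ‖R‖ * (1 / (‖R‖ + 1) * ‖v‖) = ‖R‖ / (‖R‖ + 1) * ‖v‖ := by ring
      _ < 1 * ‖v‖ := by gcongr
      _ = ‖v‖ := one_mul _
  linarith

/-- The plane wave `x ↦ a ^ x` on `ℤ`, damped by the factor `(1 + ε) ^ (-|x|)`. -/
noncomputable def dampedWave (ε : ℝ) (a : ℂ) (x : ℤ) : ℂ :=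
  a ^ x * (((1 + ε)⁻¹ ^ x.natAbs : ℝ) : ℂ)

lemma norm_dampedWave {ε : ℝ} (hε : 0 < ε) {a : ℂ} (ha : ‖a‖ = 1) (x : ℤ) :
    ‖dampedWave ε a x‖ = (1 + ε)⁻¹ ^ x.natAbs := by
  rw [dampedWave, norm_mul, norm_zpow, ha, one_zpow, one_mul,
    Complex.norm_of_nonneg (by positivity)]

lemma abs_inv_pow_sub_inv_pow_le {ε : ℝ} (hε : 0 < ε) {m n : ℕ} (hmn : m ≤ n + 1)
    (hnm : n ≤ m + 1) : |(1 + ε)⁻¹ ^ m - (1 + ε)⁻¹ ^ n| ≤ ε * (1 + ε)⁻¹ ^ n := by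
  have hpos : 0 < 1 + ε := by positivity
  set r := (1 + ε)⁻¹
  have hr0 : 0 < r := by positivity
  have hrε : r * (1 + ε) = 1 := inv_mul_cancel₀ hpos.ne'
  have hsub : 1 - r = r * ε := by linarith
  have hr1 : r ≤ 1 := by nlinarith
  obtain rfl | rfl | rfl : m = n ∨ m = n + 1 ∨ n = m + 1 := by omega
  · simp only [sub_self, abs_zero]; positivity
  · have : r ^ (n + 1) - r ^ n = -(r * ε * r ^ n) := by rw [← hsub]; ring
    rw [this, abs_neg, abs_of_nonneg (by positivity), mul_assoc]
    exact mul_le_of_le_one_left (by positivity) hr1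
  · have : r ^ m - r ^ (m + 1) = ε * r ^ (m + 1) := by
      rw [show r ^ m - r ^ (m + 1) = r ^ m * (1 - r) by ring, hsub]; ring
    rw [this, abs_of_nonneg (by positivity)]

/-- The damped wave is an approximate eigenfunction of the two unit translations. -/
lemma norm_dampedWave_add_sub_le {ε : ℝ} (hε : 0 < ε) {a : ℂ} (ha : ‖a‖ = 1) (x : ℤ) {k : ℤ}
    (hk : k.natAbs = 1) :
    ‖dampedWave ε a (x + k) - a ^ k * dampedWave ε a x‖ ≤ ε * ‖dampedWave ε a x‖ := by
  have ha0 : a ≠ 0 := by rintro rfl; simp at ha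
  have heq : dampedWave ε a (x + k) - a ^ k * dampedWave ε a x =
      a ^ (x + k) * (((1 + ε)⁻¹ ^ (x + k).natAbs - (1 + ε)⁻¹ ^ x.natAbs : ℝ) : ℂ) := by
    simp only [dampedWave, zpow_add₀ ha0]
    push_cast
    ring
  rw [heq, norm_mul, norm_zpow, ha, one_zpow, one_mul, Complex.norm_real, Real.norm_eq_abs,
    norm_dampedWave hε ha]
  exact abs_inv_pow_sub_inv_pow_le hε (by omega) (by omega)

lemma summable_sq_norm_dampedWave {ε : ℝ} (hε : 0 < ε) {a : ℂ} (ha : ‖a‖ = 1) :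
    Summable fun x => ‖dampedWave ε a x‖ ^ 2 := by
  have h : Summable fun n : ℕ => ((1 + ε)⁻¹ ^ 2) ^ n := by
    refine summable_geometric_of_lt_one (by positivity) (pow_lt_one₀ (by positivity) ?_ two_ne_zero)
    exact inv_lt_one_of_one_lt₀ (by linarith)
  simp only [norm_dampedWave hε ha]
  refine Summable.of_nat_of_neg ?_ ?_ <;> simpa [← pow_mul, mul_comm] using h

/-- The product of two damped waves, as an element of `ℓ²(ℤ × ℤ)`. -/
noncomputable def dampedWaveLp {ε : ℝ} (hε : 0 < ε) {a b : ℂ} (ha : ‖a‖ = 1) (hb : ‖b‖ = 1) :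
    lp (fun _ : ℤ × ℤ => ℂ) 2 :=
  ⟨fun p => dampedWave ε a p.1 * dampedWave ε b p.2, memℓp_gen <| by
    simpa [mul_pow] using (summable_sq_norm_dampedWave hε ha).mul_of_nonneg
      (summable_sq_norm_dampedWave hε hb) (fun _ => sq_nonneg _) (fun _ => sq_nonneg _)⟩

lemma dampedWaveLp_apply {ε : ℝ} (hε : 0 < ε) {a b : ℂ} (ha : ‖a‖ = 1) (hb : ‖b‖ = 1)
    (x y : ℤ) : dampedWaveLp hε ha hb (x, y) = dampedWave ε a x * dampedWave ε b y := rfl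

lemma dampedWaveLp_ne_zero {ε : ℝ} (hε : 0 < ε) {a b : ℂ} (ha : ‖a‖ = 1) (hb : ‖b‖ = 1) :
    dampedWaveLp hε ha hb ≠ 0 := by
  intro h
  have h0 : dampedWaveLp hε ha hb (0, 0) = 0 := by rw [h]; rfl
  simp [dampedWaveLp_apply, dampedWave] at h0

/-- The difference `S ⊗ 1 + S* ⊗ 1 - 1 ⊗ S - 1 ⊗ S*` of the two discrete hopping operators. -/
noncomputable def hopping : lp (fun _ : ℤ × ℤ => ℂ) 2 →L[ℂ] lp (fun _ : ℤ × ℤ => ℂ) 2 :=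
  let U := lpReindex ((Equiv.addRight (1 : ℤ)).prodCongr (Equiv.refl ℤ))
  let V := lpReindex ((Equiv.refl ℤ).prodCongr (Equiv.addRight (1 : ℤ)))
  (U.toContinuousLinearEquiv : _ →L[ℂ] _) + (U.symm.toContinuousLinearEquiv : _ →L[ℂ] _)
    - (V.toContinuousLinearEquiv : _ →L[ℂ] _) - (V.symm.toContinuousLinearEquiv : _ →L[ℂ] _)

lemma hopping_apply (ψ : lp (fun _ : ℤ × ℤ => ℂ) 2) (x y : ℤ) :
    hopping ψ (x, y) = ψ (x + 1, y) + ψ (x - 1, y) - ψ (x, y + 1) - ψ (x, y - 1) := rfl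

lemma isSelfAdjoint_hopping : IsSelfAdjoint hopping := by
  rw [ContinuousLinearMap.isSelfAdjoint_iff']
  simp only [hopping, map_add, map_sub, LinearIsometryEquiv.adjoint_eq_symm,
    LinearIsometryEquiv.symm_symm]
  abel

lemma norm_hopping_le : ‖hopping‖ ≤ 4 := by
  refine ContinuousLinearMap.opNorm_le_bound _ (by norm_num) fun ψ => ?_
  set U := lpReindex ((Equiv.addRight (1 : ℤ)).prodCongr (Equiv.refl ℤ))
  set V := lpReindex ((Equiv.refl ℤ).prodCongr (Equiv.addRight (1 : ℤ)))
  change ‖U ψ + U.symm ψ - V ψ - V.symm ψ‖ ≤ 4 * ‖ψ‖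
  have h1 := norm_sub_le (U ψ + U.symm ψ - V ψ) (V.symm ψ)
  have h2 := norm_sub_le (U ψ + U.symm ψ) (V ψ)
  have h3 := norm_add_le (U ψ) (U.symm ψ)
  simp only [LinearIsometryEquiv.norm_map] at h1 h2 h3
  linarith

lemma norm_hopping_dampedWaveLp_le {ε : ℝ} (hε : 0 < ε) {a b : ℂ} (ha : ‖a‖ = 1) (hb : ‖b‖ = 1) :
    ‖(algebraMap ℂ _ (a + a⁻¹ - b - b⁻¹) - hopping) (dampedWaveLp hε ha hb)‖ ≤
      4 * ε * ‖dampedWaveLp hε ha hb‖ := by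
  refine lp_norm_le_mul_of_forall_le (by positivity) fun ⟨x, y⟩ => ?_
  change ‖(a + a⁻¹ - b - b⁻¹) * dampedWaveLp hε ha hb (x, y) -
    hopping (dampedWaveLp hε ha hb) (x, y)‖ ≤ _
  rw [hopping_apply]
  simp only [dampedWaveLp_apply]
  have hx := norm_dampedWave_add_sub_le hε ha x (k := 1) rfl
  have hx' := norm_dampedWave_add_sub_le hε ha x (k := -1) rfl
  have hy := norm_dampedWave_add_sub_le hε hb y (k := 1) rfl
  have hy' := norm_dampedWave_add_sub_le hε hb y (k := -1) rfl
  simp only [zpow_one, zpow_neg, ← sub_eq_add_neg] at hx hx' hy hy'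
  set f := dampedWave ε a
  set g := dampedWave ε b
  have heq : (a + a⁻¹ - b - b⁻¹) * (f x * g y) -
      (f (x + 1) * g y + f (x - 1) * g y - f x * g (y + 1) - f x * g (y - 1)) =
      f x * ((g (y + 1) - b * g y) + (g (y - 1) - b⁻¹ * g y)) -
      ((f (x + 1) - a * f x) + (f (x - 1) - a⁻¹ * f x)) * g y := by ring
  rw [heq]
  calc _ ≤ ‖f x‖ * (ε * ‖g y‖ + ε * ‖g y‖) + (ε * ‖f x‖ + ε * ‖f x‖) * ‖g y‖ := by
        refine (norm_sub_le _ _).trans ?_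
        rw [norm_mul, norm_mul]
        gcongr
        · exact (norm_add_le _ _).trans (add_le_add hy hy')
        · exact (norm_add_le _ _).trans (add_le_add hx hx')
    _ = 4 * ε * ‖f x * g y‖ := by rw [norm_mul]; ring

lemma mem_spectrum_hopping {a b : ℂ} (ha : ‖a‖ = 1) (hb : ‖b‖ = 1) :
    a + a⁻¹ - b - b⁻¹ ∈ spectrum ℂ hopping := by
  rw [spectrum.mem_iff]
  refine not_isUnit_of_approx_null _ fun ε hε => ?_
  have hε' : 0 < ε / 4 := by positivity
  refine ⟨dampedWaveLp hε' ha hb, dampedWaveLp_ne_zero hε' ha hb, ?_⟩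
  simpa [mul_div_cancel₀] using norm_hopping_dampedWaveLp_le hε' ha hb

lemma spectrum_hopping :
    spectrum ℂ hopping = {w : ℂ | ∃ t : ℝ, -4 ≤ t ∧ t ≤ 4 ∧ w = t} := by
  ext w
  constructor
  · intro hw
    have hre := isSelfAdjoint_hopping.mem_spectrum_eq_re hw
    have hle : |w.re| ≤ 4 := (Complex.abs_re_le_norm w).trans <|
      (spectrum.norm_le_norm_mul_of_mem hw).trans <|
        (mul_le_of_le_one_right (norm_nonneg _) ContinuousLinearMap.norm_id_le).trans
          norm_hopping_le
    exact ⟨w.re, (abs_le.1 hle).1, (abs_le.1 hle).2, hre⟩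
  · rintro ⟨t, ht, ht', rfl⟩
    set θ := Real.arccos (t / 4)
    have hcos : Real.cos θ = t / 4 := Real.cos_arccos (by linarith) (by linarith)
    have ha : ‖Complex.exp (θ * Complex.I)‖ = 1 := Complex.norm_exp_ofReal_mul_I θ
    convert mem_spectrum_hopping ha (b := -Complex.exp (θ * Complex.I)) (by rw [norm_neg, ha])
    have h2 : (t : ℂ) = 4 * Complex.cos θ := by
      rw [← Complex.ofReal_cos, hcos]; push_cast; ring
    rw [h2, Complex.cos, ← Complex.exp_neg, inv_neg, ← Complex.exp_neg, neg_mul]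
    ring

/-- Spectrum of the (vectorized) non-Hermitian evolution for local dephasing:
for the operator `(𝒯ψ)(x,y) = i(ψ(x+1,y) + ψ(x-1,y) - ψ(x,y+1) - ψ(x,y-1)) - Gψ(x,y)`
on `ℓ²(ℤ×ℤ)` with `G > 0`, `σ(𝒯) = -G + i[-4,4]`. -/
theorem spectrum_nonHermitian_dephasing (G : ℝ) (hG : 0 < G)
    (T : lp (fun _ : ℤ × ℤ => ℂ) 2 →L[ℂ] lp (fun _ : ℤ × ℤ => ℂ) 2)
    (hT : ∀ (ψ : lp (fun _ : ℤ × ℤ => ℂ) 2) (x y : ℤ),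
      T ψ (x, y) = Complex.I * (ψ (x + 1, y) + ψ (x - 1, y) - ψ (x, y + 1) - ψ (x, y - 1))
        - (G : ℂ) * ψ (x, y)) :
    spectrum ℂ T = {z : ℂ | ∃ t : ℝ, -4 ≤ t ∧ t ≤ 4 ∧ z = -(G : ℂ) + Complex.I * (t : ℂ)} := by
  have hz : ∀ z : ℂ, z ∈ spectrum ℂ T ↔ -Complex.I * (z + G) ∈ spectrum ℂ hopping := by
    intro z
    have heq : algebraMap ℂ _ z - T =
        Units.mk0 Complex.I Complex.I_ne_zero •
          (algebraMap ℂ _ (-Complex.I * (z + G)) - hopping) := by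
      ext ψ ⟨x, y⟩
      change z * ψ (x, y) - T ψ (x, y) =
        Complex.I * (-Complex.I * (z + G) * ψ (x, y) - hopping ψ (x, y))
      rw [hT, hopping_apply]
      linear_combination ((z + G) * ψ (x, y)) * Complex.I_sq
    rw [spectrum.mem_iff, spectrum.mem_iff, heq, isUnit_smul_iff]
  ext z
  rw [hz, spectrum_hopping]
  refine exists_congr fun t => and_congr_right fun _ => and_congr_right fun _ => ⟨fun h => ?_, ?_⟩
  · linear_combination Complex.I * h + (z + G) * Complex.I_sq
  · rintro rfl
    linear_combination (-(t : ℂ)) * Complex.I_sq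
end

section
/- Spectrum of the Lindbladian with incoherent hopping (Theorem 5.6): Let G > 0, l ∈ ℤ, and let 𝓛 be the bounded operator on ℓ²(ℤ×ℤ) defined by (𝓛ψ)(x,y) = i·(ψ(x+1,y) + ψ(x−1,y) − ψ(x,y+1) − ψ(x,y−1)) − G·ψ(x,y) + G·(if x = y then ψ(x+l, y+l) else 0). (This is the vectorized Lindblad generator with Hamiltonian H = −(S + S*) and Lindblad operators L_k = |e_k⟩⟨e_{k+l}|, k ∈ ℤ.) Then there exists a function w : [0, 2π] → ℂ with w(q)² = e^{−2 i q l}·G² + 8·(cos q − 1) for every q ∈ [0, 2π], such that σ(𝓛) = { −G + i·t : t ∈ ℝ, −4 ≤ t ≤ 4 } ∪ { −G + w(q) : q ∈ [0, 2π] }. -/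
open Real

/-- The segment `i[-4, 4]`. -/
def imaginarySegment : Set ℂ := {z | ∃ t : ℝ, -4 ≤ t ∧ t ≤ 4 ∧ z = Complex.I * (t : ℂ)}

lemma mem_imaginarySegment_of_sq {z : ℂ} {t : ℝ} (h0 : 0 ≤ t) (h16 : t ≤ 16)
    (h : z ^ 2 = -(t : ℂ)) : z ∈ imaginarySegment := by
  have hs : √t ≤ 4 := by
    rw [Real.sqrt_le_left (by norm_num)]; norm_num; exact h16
  have hs0 := Real.sqrt_nonneg t
  have hsq : ((√t : ℝ) : ℂ) ^ 2 = t := by exact_mod_cast Real.sq_sqrt h0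
  have : z ^ 2 = (Complex.I * (√t : ℝ)) ^ 2 := by
    rw [h, mul_pow, hsq, Complex.I_sq]; ring
  rcases sq_eq_sq_iff_eq_or_eq_neg.1 this with h | h
  · exact ⟨√t, by linarith, hs, h⟩
  · exact ⟨-√t, by linarith, by linarith, by rw [h]; push_cast; ring⟩

lemma neg_mem_imaginarySegment {z : ℂ} (hz : z ∈ imaginarySegment) : -z ∈ imaginarySegment := by
  obtain ⟨t, h1, h2, rfl⟩ := hz
  exact ⟨-t, by linarith, by linarith, by push_cast; ring⟩

lemma ne_zero_of_notMem_imaginarySegment {z : ℂ} (hz : z ∉ imaginarySegment) : z ≠ 0 := by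
  rintro rfl
  exact hz ⟨0, by norm_num, by norm_num, by simp⟩

/-- The branch of the square root of `z² + 8(1 - Re ζ)` that is asymptotic to `z`. -/
noncomputable def dispersionRoot (z ζ : ℂ) : ℂ :=
  z * Complex.sqrt (1 + ((8 - 8 * ζ.re : ℝ) : ℂ) / z ^ 2)

lemma dispersionRoot_sq {z : ℂ} (hz : z ≠ 0) (ζ : ℂ) :
    dispersionRoot z ζ ^ 2 = z ^ 2 + ((8 - 8 * ζ.re : ℝ) : ℂ) := by
  have h := Complex.cpow_nat_inv_pow (1 + ((8 - 8 * ζ.re : ℝ) : ℂ) / z ^ 2) (n := 2) (by norm_num)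
  rw [Nat.cast_ofNat] at h
  rw [dispersionRoot, Complex.sqrt, mul_pow, h]
  field_simp

lemma dispersionRoot_neg (z ζ : ℂ) : dispersionRoot (-z) ζ = -dispersionRoot z ζ := by
  simp [dispersionRoot]

lemma re_bounds_of_norm_eq_one {ζ : ℂ} (hζ : ‖ζ‖ = 1) : -1 ≤ ζ.re ∧ ζ.re ≤ 1 :=
  abs_le.1 (hζ ▸ Complex.abs_re_le_norm ζ)

lemma one_add_div_sq_mem_slitPlane {z ζ : ℂ} (hz : z ∉ imaginarySegment) (hζ : ‖ζ‖ = 1) :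
    1 + ((8 - 8 * ζ.re : ℝ) : ℂ) / z ^ 2 ∈ Complex.slitPlane := by
  obtain ⟨h1, h2⟩ := re_bounds_of_norm_eq_one hζ
  have hz0 := ne_zero_of_notMem_imaginarySegment hz
  by_contra hs
  rw [Complex.mem_slitPlane_iff_not_le_zero, not_not] at hs
  obtain ⟨hre, him⟩ := Complex.le_def.1 hs
  set k : ℝ := 8 - 8 * ζ.re with hk
  set u := 1 + (k : ℂ) / z ^ 2 with hu
  have hur : u = (u.re : ℂ) := Complex.ext (by simp) (by simpa using him)
  have hre' : u.re ≤ 0 := by simpa using hre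
  have hpos : 0 < 1 - u.re := by linarith
  refine hz (mem_imaginarySegment_of_sq (t := k / (1 - u.re)) (by apply div_nonneg <;> linarith)
    ((div_le_self (by linarith) (by linarith)).trans (by linarith)) ?_)
  have h3 : (1 - u.re : ℂ) ≠ 0 := by exact_mod_cast hpos.ne'
  have h4 : (1 - (u.re : ℂ)) * z ^ 2 = -k := by
    rw [← hur, hu]; field_simp; ring
  push_cast
  field_simp
  linear_combination h4

lemma norm_sub_dispersionRoot_lt {z ζ : ℂ} (hz : z ∉ imaginarySegment) (hζ : ‖ζ‖ = 1) :
    ‖z - dispersionRoot z ζ‖ < ‖z + dispersionRoot z ζ‖ := by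
  have hz0 := ne_zero_of_notMem_imaginarySegment hz
  have hs := one_add_div_sq_mem_slitPlane hz hζ
  set u := 1 + ((8 - 8 * ζ.re : ℝ) : ℂ) / z ^ 2 with hu
  have hre : 0 < (Complex.sqrt u).re := by
    rw [Complex.sqrt, Complex.cpow_inv_two_re]
    have h1 := Complex.abs_re_le_norm u
    have h2 := neg_abs_le u.re
    refine Real.sqrt_pos.2 (half_pos (lt_of_le_of_ne (by linarith) fun h => ?_))
    rw [Complex.mem_slitPlane_iff_not_le_zero] at hs
    have hre : u.re ≤ 0 := by linarith [norm_nonneg u]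
    refine hs (Complex.le_def.2 ⟨by simpa using hre, ?_⟩)
    exact Complex.abs_re_eq_norm.1 (by rw [abs_of_nonpos hre]; linarith)
  have key : ‖1 - Complex.sqrt u‖ < ‖1 + Complex.sqrt u‖ := by
    rw [← sq_lt_sq₀ (norm_nonneg _) (norm_nonneg _), ← Complex.normSq_eq_norm_sq,
      ← Complex.normSq_eq_norm_sq, Complex.normSq_apply, Complex.normSq_apply]
    simp
    nlinarith
  have e1 : z - dispersionRoot z ζ = z * (1 - Complex.sqrt u) := by rw [dispersionRoot]; ring
  have e2 : z + dispersionRoot z ζ = z * (1 + Complex.sqrt u) := by rw [dispersionRoot]; ring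
  rw [e1, e2, norm_mul, norm_mul]
  exact mul_lt_mul_of_pos_left key (norm_pos_iff.2 hz0)

lemma add_dispersionRoot_ne_zero {z ζ : ℂ} (hz : z ∉ imaginarySegment) (hζ : ‖ζ‖ = 1) :
    z + dispersionRoot z ζ ≠ 0 :=
  norm_pos_iff.1 ((norm_nonneg _).trans_lt (norm_sub_dispersionRoot_lt hz hζ))

lemma dispersionRoot_ne_zero {z ζ : ℂ} (hz : z ∉ imaginarySegment) (hζ : ‖ζ‖ = 1) :
    dispersionRoot z ζ ≠ 0 := fun h => by
  simpa [h] using norm_sub_dispersionRoot_lt hz hζ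

lemma continuousOn_dispersionRoot {z : ℂ} (hz : z ∉ imaginarySegment) :
    ContinuousOn (dispersionRoot z) (Metric.sphere 0 1) := by
  unfold dispersionRoot Complex.sqrt
  refine continuousOn_const.mul (ContinuousOn.cpow_const ?_ fun ζ hζ =>
    one_add_div_sq_mem_slitPlane hz (by simpa using hζ))
  fun_prop

section Operator

variable {A : Type*} [CStarAlgebra A]

lemma isUnit_one_sub_mul_comm (a b : A) : IsUnit (1 - a * b) ↔ IsUnit (1 - b * a) := by
  have := spectrum.unit_mem_mul_comm (R := ℂ) (a := a) (b := b) (r := 1)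
  simpa [spectrum.mem_iff, not_iff_not] using this

/-- If `P` kills all positive powers of `x`, then `P (1 - x)⁻¹ P = P²`. -/
lemma compress_geometric {P x U : A} (hx : ‖x‖ < 1) (h : ∀ n : ℕ, P * x ^ (n + 1) * P = 0)
    (hU : U * (1 - x) = 1) : P * U * P = P * P := by
  have hs := summable_geometric_of_norm_lt_one hx
  have hUe : U = ∑' n : ℕ, x ^ n :=
    left_inv_eq_right_inv hU (by simpa using mul_neg_geom_series x hx)
  have h1 : HasSum (fun n : ℕ => P * x ^ n * P) (P * U * P) :=
    hUe ▸ (hs.hasSum.mul_left P).mul_right P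
  refine h1.unique ?_
  convert hasSum_single (f := fun n : ℕ => P * x ^ n * P) 0 ?_ using 1
  · simp
  · intro n hn
    obtain ⟨m, rfl⟩ := Nat.exists_eq_succ_of_ne_zero hn
    exact h m

/-- The operator `i(D + D* - D*S - DS*)`. -/
noncomputable def freeGenerator (S D : unitary A) : A :=
  Complex.I • ((D : A) + star (D : A) - star (D : A) * S - D * star (S : A))

lemma norm_le_one_of_unitary (u : unitary A) : ‖(u : A)‖ ≤ 1 := by
  nontriviality A
  exact (CStarRing.norm_coe_unitary u).le

lemma norm_eq_one_of_mem_spectrum (S : unitary A) (ζ : spectrum ℂ (S : A)) : ‖(ζ : ℂ)‖ = 1 := by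
  simpa using spectrum.subset_circle_of_unitary S.2 ζ.2

/-- The continuous functional calculus of a unitary. -/
noncomputable def unitaryCalculus (S : unitary A) : C(spectrum ℂ (S : A), ℂ) →⋆ₐ[ℂ] A :=
  cfcHom (R := ℂ) (a := (S : A)) (p := IsStarNormal) inferInstance

/-- The dispersion root as a continuous function on the spectrum of a unitary. -/
noncomputable def dispersionMap (S : unitary A) {z : ℂ} (hz : z ∉ imaginarySegment) :
    C(spectrum ℂ (S : A), ℂ) where
  toFun ζ := dispersionRoot z ζ
  continuous_toFun := ((continuousOn_dispersionRoot hz).mono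
    (spectrum.subset_circle_of_unitary S.2)).domRestrict

lemma commute_star_unitary {S : unitary A} {b : A} (h : Commute (S : A) b) :
    Commute (star (S : A)) b := by
  have hSS : (S : A) * star (S : A) = 1 := Unitary.mul_star_self_of_mem S.2
  have hSS' : star (S : A) * (S : A) = 1 := Unitary.star_mul_self_of_mem S.2
  calc star (S : A) * b = star (S : A) * (b * (S * star (S : A))) := by rw [hSS, mul_one]
    _ = star (S : A) * (b * S) * star (S : A) := by simp only [mul_assoc]
    _ = star (S : A) * (S * b) * star (S : A) := by rw [h.eq]
    _ = b * star (S : A) := by rw [← mul_assoc (star (S : A)), hSS', one_mul]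

lemma commute_unitaryCalculus {S : unitary A} {b : A} (h : Commute (S : A) b)
    (f : C(spectrum ℂ (S : A), ℂ)) : Commute (unitaryCalculus S f) b :=
  Commute.cfcHom _ h (commute_star_unitary h) f

lemma ne_zero_of_mem_spectrum (S : unitary A) (ζ : spectrum ℂ (S : A)) : (ζ : ℂ) ≠ 0 :=
  norm_ne_zero_iff.1 (by simp [norm_eq_one_of_mem_spectrum S ζ])

/-- The continuous function `ζ ^ l` on the spectrum of a unitary. -/
noncomputable def zpowMap (S : unitary A) (l : ℤ) : C(spectrum ℂ (S : A), ℂ) where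
  toFun ζ := (ζ : ℂ) ^ l
  continuous_toFun := Continuous.zpow₀ continuous_subtype_val l
    fun ζ => Or.inl (ne_zero_of_mem_spectrum S ζ)

lemma unitaryCalculus_zpowMap (S : unitary A) (l : ℤ) :
    unitaryCalculus S (zpowMap S l) = ((S ^ l : unitary A) : A) := by
  have h := cfc_zpow (R := ℂ) (p := IsStarNormal) (Unitary.toUnits S) l
    (inferInstanceAs (IsStarNormal (S : A)))
  rw [← map_zpow] at h
  refine Eq.trans ?_ h
  rw [cfc_apply (R := ℂ) (fun ζ : ℂ => ζ ^ l) (Unitary.toUnits S : A)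
    (inferInstanceAs (IsStarNormal (S : A)))
    (fun ζ hζ => (continuousAt_zpow₀ ζ l (Or.inl
      (ne_zero_of_mem_spectrum S ⟨ζ, hζ⟩))).continuousWithinAt)]
  rfl

/-- The continuous function `G ζ^l / s(ζ)` on the spectrum of a unitary, where `s` is the
dispersion root. -/
noncomputable def reducedSymbol (S : unitary A) {z : ℂ} (hz : z ∉ imaginarySegment) (G : ℂ)
    (l : ℤ) : C(spectrum ℂ (S : A), ℂ) where
  toFun ζ := G * (ζ : ℂ) ^ l / dispersionRoot z ζ
  continuous_toFun := (continuous_const.mul (zpowMap S l).continuous).div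
    (dispersionMap S hz).continuous fun ζ =>
      dispersionRoot_ne_zero hz (norm_eq_one_of_mem_spectrum S ζ)

theorem isUnit_sub_freeGenerator_iff {S D : unitary A} (hSD : Commute S D) {P : A}
    (hSP : Commute (S : A) P) (hP : P * P = P)
    (hD : ∀ n : ℕ, P * (D : A) ^ (n + 1) * P = 0)
    (hD' : ∀ n : ℕ, P * star (D : A) ^ (n + 1) * P = 0)
    {z : ℂ} (hz : z ∉ imaginarySegment) (G : ℂ) (l : ℤ) :
    IsUnit (algebraMap ℂ A z - freeGenerator S D - G • (((S ^ l : unitary A) : A) * P)) ↔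
      IsUnit (1 - unitaryCalculus S (reducedSymbol S hz G l) * P) := by
  set Φ := unitaryCalculus S with hΦ
  have hDD : (D : A) * star (D : A) = 1 := Unitary.mul_star_self_of_mem D.2
  have hDD' : star (D : A) * (D : A) = 1 := Unitary.star_mul_self_of_mem D.2
  have hSDA : Commute (S : A) (D : A) := congrArg Subtype.val hSD.eq
  have hSDA' : Commute (S : A) (star (D : A)) := by
    simpa using (commute_star_unitary hSDA).star_star
  have comm : ∀ {b : A}, Commute (S : A) b → ∀ f, Commute (Φ f) b := fun {b} h f =>
    commute_unitaryCalculus h f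
  let s := dispersionMap S hz
  let ι : C(spectrum ℂ (S : A), ℂ) := .restrict _ (.id ℂ)
  have hΦι : Φ ι = S := cfcHom_id _
  have hΦι' : Φ (star ι) = star (S : A) := by rw [map_star, hΦι]
  have hne : ∀ ζ : spectrum ℂ (S : A), z + dispersionRoot z ζ ≠ 0 := fun ζ =>
    add_dispersionRoot_ne_zero hz (norm_eq_one_of_mem_spectrum S ζ)
  have hsne : ∀ ζ : spectrum ℂ (S : A), dispersionRoot z ζ ≠ 0 := fun ζ =>
    dispersionRoot_ne_zero hz (norm_eq_one_of_mem_spectrum S ζ)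
  let c : C(spectrum ℂ (S : A), ℂ) := ⟨fun ζ => (z + dispersionRoot z ζ) / 2, by
    exact (continuous_const.add s.continuous).div_const 2⟩
  let ci : C(spectrum ℂ (S : A), ℂ) := ⟨fun ζ => 2 / (z + dispersionRoot z ζ), by
    exact continuous_const.div (continuous_const.add s.continuous) hne⟩
  let si : C(spectrum ℂ (S : A), ℂ) := ⟨fun ζ => 1 / (dispersionRoot z ζ), by
    exact continuous_const.div s.continuous hsne⟩
  have hc : ∀ ζ, c ζ = (z + dispersionRoot z ζ) / 2 := fun _ => rfl
  have hci : ∀ ζ, ci ζ = 2 / (z + dispersionRoot z ζ) := fun _ => rfl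
  have hsi : ∀ ζ, si ζ = 1 / dispersionRoot z ζ := fun _ => rfl
  let α : C(spectrum ℂ (S : A), ℂ) := Complex.I • ((1 - star ι) * ci)
  let β : C(spectrum ℂ (S : A), ℂ) := Complex.I • ((1 - ι) * ci)
  have one_sub_norm : ∀ ζ : spectrum ℂ (S : A), ‖1 - (ζ : ℂ)‖ * 2 < ‖z + dispersionRoot z ζ‖ := by
    intro ζ
    have h1 := norm_eq_one_of_mem_spectrum S ζ
    have hlt := norm_sub_dispersionRoot_lt hz h1
    have hsq := dispersionRoot_sq (ne_zero_of_notMem_imaginarySegment hz) ζ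
    have h2 : ‖z - dispersionRoot z ζ‖ * ‖z + dispersionRoot z ζ‖ = 8 - 8 * (ζ : ℂ).re := by
      rw [← norm_mul, show (z - dispersionRoot z ζ) * (z + dispersionRoot z ζ)
        = -((8 - 8 * (ζ : ℂ).re : ℝ) : ℂ) by linear_combination -hsq, norm_neg, Complex.norm_real,
        Real.norm_of_nonneg (by linarith [(re_bounds_of_norm_eq_one h1).2])]
    have h3 : ‖1 - (ζ : ℂ)‖ ^ 2 = 2 - 2 * (ζ : ℂ).re := by
      have h4 : Complex.normSq (ζ : ℂ) = 1 := by rw [Complex.normSq_eq_norm_sq, h1]; norm_num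
      rw [Complex.normSq_apply] at h4
      rw [← Complex.normSq_eq_norm_sq, Complex.normSq_apply]
      simp
      linarith
    have h5 : 0 < ‖z + dispersionRoot z ζ‖ := norm_pos_iff.2 (hne ζ)
    nlinarith [norm_nonneg (1 - (ζ : ℂ)), norm_nonneg (z - dispersionRoot z ζ)]
  have conj_sub : ∀ ζ : ℂ, ‖1 - (starRingEnd ℂ) ζ‖ = ‖1 - ζ‖ := fun ζ => by
    rw [← Complex.norm_conj (1 - ζ)]; simp
  have hΦn : ∀ f, ‖Φ f‖ = ‖f‖ := fun f => norm_cfcHom (p := IsStarNormal) (S : A) f inferInstance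
  have hα : ‖α‖ < 1 := by
    rw [ContinuousMap.norm_lt_iff _ one_pos]
    intro ζ
    have : ‖α ζ‖ = ‖1 - (ζ : ℂ)‖ * 2 / ‖z + dispersionRoot z ζ‖ := by
      simp [α, hci, ι, conj_sub, mul_div_assoc]
    rw [this, div_lt_one (norm_pos_iff.2 (hne ζ))]
    exact one_sub_norm ζ
  have hβ : ‖β‖ < 1 := by
    rw [ContinuousMap.norm_lt_iff _ one_pos]
    intro ζ
    have : ‖β ζ‖ = ‖1 - (ζ : ℂ)‖ * 2 / ‖z + dispersionRoot z ζ‖ := by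
      simp [β, hci, ι, mul_div_assoc]
    rw [this, div_lt_one (norm_pos_iff.2 (hne ζ))]
    exact one_sub_norm ζ
  have hx : ‖Φ α * D‖ < 1 := (norm_mul_le _ _).trans_lt <| by
    rw [hΦn]
    exact (mul_le_of_le_one_right (norm_nonneg _) (norm_le_one_of_unitary D)).trans_lt hα
  have hy : ‖Φ β * star (D : A)‖ < 1 := (norm_mul_le _ _).trans_lt <| by
    rw [hΦn, norm_star]
    exact (mul_le_of_le_one_right (norm_nonneg _) (norm_le_one_of_unitary D)).trans_lt hβ
  have hcα : c * α = Complex.I • (1 - star ι) := by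
    ext ζ
    have := hne ζ
    simp [hc, α, hci]
    field_simp
  have hcβ : c * β = Complex.I • (1 - ι) := by
    ext ζ
    have := hne ζ
    simp [hc, β, hci]
    field_simp
  have hαβ : ∀ ζ, α ζ * β ζ = (z - dispersionRoot z ζ) / (z + dispersionRoot z ζ) := by
    intro ζ
    have h1 := norm_eq_one_of_mem_spectrum S ζ
    have hsq := dispersionRoot_sq (ne_zero_of_notMem_imaginarySegment hz) ζ
    have h2 := hne ζ
    have h3 : (1 - (starRingEnd ℂ) (ζ : ℂ)) * (1 - (ζ : ℂ)) = ((2 - 2 * (ζ : ℂ).re : ℝ) : ℂ) := by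
      have h4 : (starRingEnd ℂ) (ζ : ℂ) * ζ = 1 := by
        rw [mul_comm, Complex.mul_conj, Complex.normSq_eq_norm_sq, h1]; norm_num
      have h5 := Complex.add_conj (ζ : ℂ)
      push_cast at h5 ⊢
      linear_combination h4 - h5
    have h6 : α ζ * β ζ = Complex.I ^ 2 * ((1 - (starRingEnd ℂ) (ζ : ℂ)) * (1 - (ζ : ℂ))) *
        (2 / (z + dispersionRoot z ζ)) ^ 2 := by
      have h7 : α ζ = Complex.I * ((1 - (starRingEnd ℂ) (ζ : ℂ)) * (2 / (z + dispersionRoot z ζ))) :=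
        rfl
      have h8 : β ζ = Complex.I * ((1 - (ζ : ℂ)) * (2 / (z + dispersionRoot z ζ))) := rfl
      rw [h7, h8]
      ring
    rw [h6, h3, Complex.I_sq]
    field_simp
    push_cast at hsq ⊢
    linear_combination hsq
  have hcz : c * (1 + α * β) = algebraMap ℂ _ z := by
    ext ζ
    have := hne ζ
    simp [hαβ, hc]
    field_simp
    ring
  have hcs : c * si * (1 - α * β) = 1 := by
    ext ζ
    have := hne ζ
    have := hsne ζ
    simp [hαβ, hc, hsi]
    field_simp
    ring
  have hccu : IsUnit c := (ContinuousMap.isUnit_iff_forall_ne_zero c).2 fun ζ => by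
    simpa [hc] using hne ζ
  have hxy : Φ α * D * (Φ β * star (D : A)) = Φ (α * β) := by
    rw [map_mul, mul_assoc, ← mul_assoc (D : A), ← (comm hSDA β).eq, mul_assoc (Φ β), hDD, mul_one]
  have hyx : Φ β * star (D : A) * (Φ α * D) = Φ (α * β) := by
    rw [mul_comm α, map_mul, mul_assoc, ← mul_assoc (star (D : A)), ← (comm hSDA' α).eq,
      mul_assoc (Φ α), hDD', mul_one]
  have hZ : algebraMap ℂ A z - freeGenerator S D
      = Φ c * ((1 - Φ α * D) * (1 - Φ β * star (D : A))) := by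
    have e : Φ c * ((1 - Φ α * D) * (1 - Φ β * star (D : A)))
        = Φ (c * (1 + α * β)) - Φ (c * α) * D - Φ (c * β) * star (D : A) := by
      rw [map_mul _ c (1 + _), map_add, map_one, ← hxy, map_mul, map_mul]
      noncomm_ring
    rw [e, hcz, hcα, hcβ, AlgHomClass.commutes, map_smul, map_smul, map_sub, map_sub, hΦι, hΦι',
      map_one, freeGenerator, ← (commute_star_unitary hSDA).eq, ← hSDA'.eq, smul_mul_assoc,
      smul_mul_assoc, sub_mul, sub_mul, sub_sub (algebraMap ℂ A z), ← smul_add]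
    congr 2
    noncomm_ring
  obtain ⟨U, hU⟩ := isUnit_one_sub_of_norm_lt_one hx
  obtain ⟨V, hV⟩ := isUnit_one_sub_of_norm_lt_one hy
  have hPU : P * (↑U⁻¹ : A) * P = P := by
    refine (compress_geometric hx (fun n => ?_) (by rw [← hU, Units.inv_mul])).trans hP
    rw [(comm hSDA α).mul_pow, ← mul_assoc, ← map_pow, ← (comm hSP (α ^ (n + 1))).eq, mul_assoc,
      mul_assoc, ← mul_assoc P, hD, mul_zero]
  have hPV : P * (↑V⁻¹ : A) * P = P := by
    refine (compress_geometric hy (fun n => ?_) (by rw [← hV, Units.inv_mul])).trans hP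
    rw [(comm hSDA' β).mul_pow, ← mul_assoc, ← map_pow, ← (comm hSP (β ^ (n + 1))).eq, mul_assoc,
      mul_assoc, ← mul_assoc P, hD', mul_zero]
  set Z := algebraMap ℂ A z - freeGenerator S D with hZdef
  have hZu : IsUnit Z := by
    rw [hZ, ← hU, ← hV]
    exact (hccu.map Φ).mul (U.isUnit.mul V.isUnit)
  set R := Φ si * ((↑U⁻¹ : A) + (↑V⁻¹ : A) - 1) with hR
  have hZR : Z * R = 1 := by
    have hVU : (V : A) * U = U * V := by
      rw [hU, hV]
      have := hxy.trans hyx.symm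
      simp only [mul_sub, sub_mul, mul_one, one_mul, this]
      abel
    have hsum : (U : A) * V * ((↑U⁻¹ : A) + (↑V⁻¹ : A) - 1) = Φ (1 - α * β) := by
      rw [mul_sub, mul_add, mul_one, Units.mul_inv_cancel_right, ← hVU,
        Units.mul_inv_cancel_right, hVU, map_sub, map_one, ← hxy, hU, hV]
      noncomm_ring
    have hcomm : Φ si * ((U : A) * V) = U * V * Φ si := by
      rw [hU, hV]
      refine Commute.eq (Commute.mul_right ?_ ?_)
      · exact (Commute.one_right _).sub_right
          (((Commute.all si α).map Φ).mul_right (comm hSDA si))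
      · exact (Commute.one_right _).sub_right
          (((Commute.all si β).map Φ).mul_right (comm hSDA' si))
    rw [hZ, ← hU, ← hV, hR, mul_assoc, ← mul_assoc _ (Φ si), ← hcomm, mul_assoc (Φ si), hsum,
      ← map_mul, ← map_mul, ← mul_assoc, hcs, map_one]
  obtain ⟨W, hW⟩ := hZu
  have hRW : R = (↑W⁻¹ : A) := by
    rw [← hW] at hZR
    exact (Units.inv_eq_of_mul_eq_one_right hZR).symm
  have hPRP : P * R * P = Φ si * P := by
    rw [hR, ← mul_assoc, ← (comm hSP si).eq, mul_assoc, mul_assoc, sub_mul, mul_sub, add_mul,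
      mul_add, ← mul_assoc, ← mul_assoc, hPU, hPV, one_mul, hP]
    simp
  have hSl : Commute ((S ^ l : unitary A) : A) P := by
    rw [← unitaryCalculus_zpowMap]
    exact comm hSP _
  set B : A := ((S ^ l : unitary A) : A) with hB
  have hfac : Z - G • (B * P) = (1 - P * (G • (B * P * R))) * Z := by
    rw [sub_mul, one_mul, mul_smul_comm, smul_mul_assoc, mul_assoc P, mul_assoc _ R, hRW, ← hW,
      Units.inv_mul, mul_one, hSl.eq, ← mul_assoc, hP]
  have hred : G • (B * P * R) * P = Φ (reducedSymbol S hz G l) * P := by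
    have : reducedSymbol S hz G l = G • (zpowMap S l * si) := by
      ext ζ
      change G * (ζ : ℂ) ^ l / dispersionRoot z ζ = G * ((ζ : ℂ) ^ l * (1 / dispersionRoot z ζ))
      ring
    rw [smul_mul_assoc, mul_assoc, mul_assoc, ← mul_assoc P, hPRP, this, map_smul, map_mul,
      unitaryCalculus_zpowMap, smul_mul_assoc, mul_assoc]
  rw [hfac, ← hW, Units.isUnit_mul_units, isUnit_one_sub_mul_comm, hred]

lemma isUnit_one_sub_calculus_mul {S : unitary A} {P : A} (hSP : Commute (S : A) P)
    (hP : P * P = P) {g : C(spectrum ℂ (S : A), ℂ)} (hg : ∀ ζ, g ζ ≠ 1) :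
    IsUnit (1 - unitaryCalculus S g * P) := by
  obtain ⟨k, hk⟩ := (ContinuousMap.isUnit_iff_forall_ne_zero (1 - g)).2 fun ζ => by
    simpa [sub_eq_zero] using (hg ζ).symm
  have comm : ∀ f, Commute (unitaryCalculus S f) P := commute_unitaryCalculus hSP
  set Φ := unitaryCalculus S
  set Y := Φ (↑k⁻¹ : C(spectrum ℂ (S : A), ℂ)) with hY
  have h1 : Φ g * Y = Y - 1 := by
    have : g * (↑k⁻¹ : C(spectrum ℂ (S : A), ℂ)) = ↑k⁻¹ - 1 := by
      rw [show g = 1 - k by rw [hk]; ring, sub_mul, Units.mul_inv, one_mul]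
    rw [hY, ← map_mul, this, map_sub, map_one]
  have h2 : Y * Φ g = Y - 1 := by
    rw [← h1]; exact ((Commute.all _ _).map Φ).eq
  have h3 := (comm g).eq
  have h4 : P * Y = Y * P := (comm _).eq.symm
  refine ⟨⟨1 - Φ g * P, 1 - P + Y * P, ?_, ?_⟩, rfl⟩
  · have : Φ g * P * (1 - P + Y * P) = Φ g * Y * (P * P) := by
      rw [mul_add, mul_sub, mul_one, mul_assoc, hP, sub_self, zero_add, ← mul_assoc,
        mul_assoc (Φ g), h4]
      simp only [mul_assoc, hP]
    rw [sub_mul, this, h1, hP]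
    noncomm_ring
  · have : (1 - P + Y * P) * (Φ g * P) = Y * Φ g * (P * P) := by
      rw [h3, ← mul_assoc, add_mul, sub_mul, one_mul, hP, sub_self, zero_add, mul_assoc, mul_assoc,
        ← mul_assoc P P, hP, ← h3, mul_assoc]
    rw [mul_sub, this, h2, hP]
    noncomm_ring

end Operator

section ApproximateEigenvectors

open Filter Topology

variable {H : Type*} [NormedAddCommGroup H] [InnerProductSpace ℂ H]

lemma not_isUnit_of_tendsto {X : H →L[ℂ] H} {u : ℕ → H} (hu : ∀ n, ‖u n‖ = 1)
    (h : Tendsto (fun n => X (u n)) atTop (𝓝 0)) : ¬IsUnit X := by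
  rintro ⟨W, rfl⟩
  have h1 := ((↑W⁻¹ : H →L[ℂ] H).continuous.tendsto 0).comp h
  have h2 : ((↑W⁻¹ : H →L[ℂ] H) ∘ fun n => (W : H →L[ℂ] H) (u n)) = u := by
    funext n
    change ((↑W⁻¹ : H →L[ℂ] H) * W) (u n) = u n
    rw [Units.inv_mul]
    rfl
  rw [h2, map_zero] at h1
  have h3 := h1.norm
  simp only [hu, norm_zero] at h3
  exact one_ne_zero (tendsto_nhds_unique tendsto_const_nhds h3)

lemma mem_spectrum_of_tendsto {X : H →L[ℂ] H} {ω : ℂ} {u : ℕ → H} (hu : ∀ n, ‖u n‖ = 1)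
    (h : Tendsto (fun n => X (u n) - ω • u n) atTop (𝓝 0)) : ω ∈ spectrum ℂ X := by
  rw [spectrum.mem_iff]
  refine not_isUnit_of_tendsto hu ?_
  convert h.neg using 2 with n
  · simp [Algebra.algebraMap_eq_smul_one]
  · simp

lemma tendsto_unitaryCalculus [CompleteSpace H] {S : unitary (H →L[ℂ] H)} {u : ℕ → H}
    (hu : ∀ n, ‖u n‖ = 1) (ω : spectrum ℂ (S : H →L[ℂ] H))
    (h : Tendsto (fun n => (S : H →L[ℂ] H) (u n) - (ω : ℂ) • u n) atTop (𝓝 0))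
    (f : C(spectrum ℂ (S : H →L[ℂ] H), ℂ)) :
    Tendsto (fun n => unitaryCalculus S f (u n) - f ω • u n) atTop (𝓝 0) := by
  have hid : unitaryCalculus S (.restrict _ (.id ℂ)) = S := cfcHom_id _
  induction f using ContinuousMap.induction_on_of_compact with
  | const r =>
    have : unitaryCalculus S (.const _ r) = algebraMap ℂ _ r :=
      AlgHomClass.commutes (unitaryCalculus S) r
    simp [this, Algebra.algebraMap_eq_smul_one]
  | id => rw [hid]; exact h
  | star_id =>
    rw [map_star, hid]
    have h1 := ((-(starRingEnd ℂ (ω : ℂ)) • star (S : H →L[ℂ] H)).continuous.tendsto 0).comp h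
    rw [map_zero] at h1
    refine h1.congr fun n => ?_
    have h2 : star (S : H →L[ℂ] H) ((S : H →L[ℂ] H) (u n)) = u n := by
      change (star (S : H →L[ℂ] H) * (S : H →L[ℂ] H)) (u n) = u n
      rw [Unitary.star_mul_self_of_mem S.2]
      rfl
    have h3 : (starRingEnd ℂ (ω : ℂ)) * ω = 1 := by
      rw [mul_comm, Complex.mul_conj, Complex.normSq_eq_norm_sq, norm_eq_one_of_mem_spectrum S ω]
      norm_num
    simp [h2, smul_smul, h3, smul_sub]
  | add f g hf hg =>
    convert hf.add hg using 2 with n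
    · simp [add_smul]; abel
    · simp
  | mul f g hf hg =>
    have h1 := ((unitaryCalculus S f).continuous.tendsto 0).comp hg
    rw [map_zero] at h1
    convert h1.add (hf.const_smul (g ω)) using 2 with n
    · simp [mul_smul, smul_sub, smul_comm (f ω)]
    · simp
  | frequently f hf =>
    rw [Metric.tendsto_atTop]
    intro ε hε
    obtain ⟨g, hg, hgf⟩ :=
      (hf.and_eventually (Metric.ball_mem_nhds f (by positivity : 0 < ε / 4))).exists
    rw [Metric.tendsto_atTop] at hg
    obtain ⟨N, hN⟩ := hg (ε / 4) (by positivity)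
    refine ⟨N, fun n hn => ?_⟩
    have h1 := hN n hn
    rw [dist_zero_right] at h1 ⊢
    have h2 : ‖f - g‖ < ε / 4 := by rwa [dist_comm, dist_eq_norm] at hgf
    have h3 : ‖unitaryCalculus S (f - g) (u n)‖ ≤ ‖f - g‖ := by
      refine ((unitaryCalculus S (f - g)).le_opNorm (u n)).trans ?_
      rw [hu, mul_one]
      exact (norm_cfcHom (p := IsStarNormal) (S : H →L[ℂ] H) (f - g) inferInstance).le
    have h4 : ‖(f - g) ω • u n‖ ≤ ‖f - g‖ := by
      rw [norm_smul, hu, mul_one]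
      exact (f - g).norm_coe_le_norm ω
    have h5 : unitaryCalculus S f (u n) - f ω • u n = unitaryCalculus S (f - g) (u n)
        - (f - g) ω • u n + (unitaryCalculus S g (u n) - g ω • u n) := by
      simp [sub_smul]
      abel
    rw [h5]
    have := norm_add_le (unitaryCalculus S (f - g) (u n) - (f - g) ω • u n)
      (unitaryCalculus S g (u n) - g ω • u n)
    have := norm_sub_le (unitaryCalculus S (f - g) (u n)) ((f - g) ω • u n)
    linarith

lemma sum_range_telescope (V : H →L[ℂ] H) {ω : ℂ} {e : ℤ → H} (hV : ∀ j, V (e j) = ω • e (j - 1))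
    (n : ℕ) : V (∑ j ∈ Finset.range n, e j) - ω • ∑ j ∈ Finset.range n, e j
      = ω • (e (-1) - e (n - 1)) := by
  induction n with
  | zero => simp
  | succ n ih =>
    rw [Finset.sum_range_succ, map_add, smul_add, add_sub_add_comm, ih, hV]
    simp [smul_sub]

lemma norm_sum_range_telescope_le (V : H →L[ℂ] H) {ω : ℂ} (hω : ‖ω‖ = 1) {e : ℤ → H}
    (hV : ∀ j, V (e j) = ω • e (j - 1)) {C : ℝ} (he : ∀ j, ‖e j‖ = C) (n : ℕ) :
    ‖V (∑ j ∈ Finset.range n, e j) - ω • ∑ j ∈ Finset.range n, e j‖ ≤ 2 * C := by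
  rw [sum_range_telescope V hV, norm_smul, hω, one_mul]
  refine (norm_sub_le _ _).trans ?_
  rw [he, he]
  linarith

end ApproximateEigenvectors

section Lattice

open Filter Topology

/-- Square-summable functions on `ℤ × ℤ`. -/
local notation "ℋ" => lp (fun _ : ℤ × ℤ => ℂ) 2

lemma memℓp_translate (v : ℤ × ℤ) (ψ : ℋ) : Memℓp (fun p => ψ (p + v)) 2 := by
  have h := lp.memℓp ψ
  rw [memℓp_gen_iff (by norm_num)] at h ⊢
  exact (Equiv.addRight v).summable_iff.2 h

/-- Translation by `v` as an isometry of `ℓ²(ℤ × ℤ)`. -/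
noncomputable def shiftIsometry (v : ℤ × ℤ) : ℋ ≃ₗᵢ[ℂ] ℋ where
  toFun ψ := ⟨fun p => ψ (p + v), memℓp_translate v ψ⟩
  invFun ψ := ⟨fun p => ψ (p + -v), memℓp_translate (-v) ψ⟩
  map_add' ψ φ := rfl
  map_smul' c ψ := rfl
  left_inv ψ := by ext p; simp
  right_inv ψ := by ext p; simp
  norm_map' ψ := by
    rw [lp.norm_eq_tsum_rpow (by norm_num), lp.norm_eq_tsum_rpow (by norm_num)]
    congr 1
    exact (Equiv.addRight v).tsum_eq (fun p => ‖ψ p‖ ^ (2 : ENNReal).toReal)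

/-- The translations of `ℓ²(ℤ × ℤ)` as a unitary representation. -/
noncomputable def shift : Multiplicative (ℤ × ℤ) →* unitary (ℋ →L[ℂ] ℋ) where
  toFun v := Unitary.linearIsometryEquiv.symm (shiftIsometry v.toAdd)
  map_one' := by
    rw [EmbeddingLike.map_eq_one_iff]
    ext ψ p
    simp [shiftIsometry]
  map_mul' v w := by
    rw [← map_mul]
    congr 1
    ext ψ p
    change ψ (p + (v.toAdd + w.toAdd)) = ψ (p + v.toAdd + w.toAdd)
    rw [add_assoc]

lemma shift_apply (v : Multiplicative (ℤ × ℤ)) (ψ : ℋ) (p : ℤ × ℤ) :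
    (shift v : ℋ →L[ℂ] ℋ) ψ p = ψ (p + v.toAdd) := rfl

lemma shift_single (v : Multiplicative (ℤ × ℤ)) (p : ℤ × ℤ) (c : ℂ) :
    (shift v : ℋ →L[ℂ] ℋ) (lp.single 2 p c) = lp.single 2 (p - v.toAdd) c := by
  ext q
  rw [shift_apply, lp.single_apply, lp.single_apply, Pi.single_apply, Pi.single_apply]
  simp only [eq_sub_iff_add_eq]

lemma star_shift (v : Multiplicative (ℤ × ℤ)) :
    star (shift v : ℋ →L[ℂ] ℋ) = (shift v⁻¹ : ℋ →L[ℂ] ℋ) := by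
  rw [map_inv]
  rfl

lemma norm_sum_single_sq {κ : Type*} (s : Finset κ) {φ : κ → ℤ × ℤ} (hφ : φ.Injective)
    {c : κ → ℂ} (hc : ∀ k, ‖c k‖ = 1) :
    ‖∑ k ∈ s, (lp.single 2 (φ k) (c k) : ℋ)‖ ^ 2 = s.card := by
  have h := lp.norm_sum_single (p := 2) (E := fun _ : ℤ × ℤ => ℂ) (by norm_num)
    (Function.extend φ c 0) (s.map ⟨φ, hφ⟩)
  simp only [Finset.sum_map, Function.Embedding.coeFn_mk, hφ.extend_apply] at h
  simpa [hc] using h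

lemma norm_sum_single {κ : Type*} (s : Finset κ) {φ : κ → ℤ × ℤ} (hφ : φ.Injective)
    {c : κ → ℂ} (hc : ∀ k, ‖c k‖ = 1) :
    ‖∑ k ∈ s, (lp.single 2 (φ k) (c k) : ℋ)‖ = √s.card := by
  rw [← norm_sum_single_sq s hφ hc, Real.sqrt_sq (norm_nonneg _)]

/-- The diagonal translation. -/
noncomputable abbrev diagShift : unitary (ℋ →L[ℂ] ℋ) := shift (Multiplicative.ofAdd (1, 1))

/-- Translation in the first coordinate. -/
noncomputable abbrev leftShift : unitary (ℋ →L[ℂ] ℋ) := shift (Multiplicative.ofAdd (1, 0))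

lemma tendsto_two_div_sqrt : Tendsto (fun n : ℕ => 2 / √((n + 1 : ℕ) : ℝ)) atTop (𝓝 0) := by
  refine Tendsto.const_div_atTop (Real.tendsto_sqrt_atTop.comp ?_) 2
  exact tendsto_natCast_atTop_atTop.comp (tendsto_add_atTop_nat 1)

/-- Normalized plane waves supported on the diagonal. -/
lemma exists_diagonal_approx {ω : ℂ} (hω : ‖ω‖ = 1) : ∃ u : ℕ → ℋ, (∀ n, ‖u n‖ = 1) ∧
    (∀ n x y, x ≠ y → u n (x, y) = 0) ∧
    Tendsto (fun n => (diagShift : ℋ →L[ℂ] ℋ) (u n) - ω • u n) atTop (𝓝 0) := by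
  have hω0 : ω ≠ 0 := norm_ne_zero_iff.1 (by simp [hω])
  let e : ℤ → ℋ := fun j => lp.single 2 (j, j) (ω ^ j)
  have he : ∀ j, ‖e j‖ = 1 := fun j => by simp [e, lp.norm_single, hω]
  have hS : ∀ j, (diagShift : ℋ →L[ℂ] ℋ) (e j) = ω • e (j - 1) := fun j => by
    simp only [e, shift_single, ← lp.single_smul, smul_eq_mul]
    rw [← zpow_one_add₀ hω0]
    simp
  let v : ℕ → ℋ := fun n => ∑ j ∈ Finset.range (n + 1), e j
  have hv : ∀ n, ‖v n‖ = √((n + 1 : ℕ) : ℝ) := fun n => by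
    have := norm_sum_single (Finset.range (n + 1)) (φ := fun j : ℕ => ((j : ℤ), (j : ℤ)))
      (fun i j h => by simpa using h) (c := fun j : ℕ => ω ^ (j : ℤ)) (by simp [hω])
    rwa [Finset.card_range] at this
  have hpos : ∀ n : ℕ, 0 < √((n + 1 : ℕ) : ℝ) := fun n => Real.sqrt_pos.2 (by positivity)
  refine ⟨fun n => ((√((n + 1 : ℕ) : ℝ))⁻¹ : ℂ) • v n, fun n => ?_, fun n x y hxy => ?_, ?_⟩
  · rw [norm_smul, hv, norm_inv, Complex.norm_real, Real.norm_of_nonneg (hpos n).le,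
      inv_mul_cancel₀ (hpos n).ne']
  · rw [lp.coeFn_smul, Pi.smul_apply, lp.coeFn_sum, Finset.sum_apply, Finset.sum_eq_zero, smul_zero]
    intro j _
    exact lp.single_apply_ne _ _ _ fun h => hxy (by simp only [Prod.mk.injEq] at h; omega)
  · refine squeeze_zero_norm (fun n => ?_) tendsto_two_div_sqrt
    rw [map_smul, smul_comm ω, ← smul_sub, norm_smul, norm_inv, Complex.norm_real,
      Real.norm_of_nonneg (hpos n).le, inv_mul_eq_div]
    gcongr
    exact (norm_sum_range_telescope_le _ hω hS he (n + 1)).trans_eq (mul_one 2)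

/-- Normalized plane waves supported off the diagonal. -/
lemma exists_offDiagonal_approx {ω η : ℂ} (hω : ‖ω‖ = 1) (hη : ‖η‖ = 1) :
    ∃ u : ℕ → ℋ, (∀ n, ‖u n‖ = 1) ∧ (∀ n x, u n (x, x) = 0) ∧
    Tendsto (fun n => (diagShift : ℋ →L[ℂ] ℋ) (u n) - ω • u n) atTop (𝓝 0) ∧
    Tendsto (fun n => (leftShift : ℋ →L[ℂ] ℋ) (u n) - η • u n) atTop (𝓝 0) := by
  have hω0 : ω ≠ 0 := norm_ne_zero_iff.1 (by simp [hω])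
  have hη0 : η ≠ 0 := norm_ne_zero_iff.1 (by simp [hη])
  let e : ℤ → ℤ → ℋ := fun j k => lp.single 2 (j + k + 1, j) (ω ^ j * η ^ k)
  have hS : ∀ j k, (diagShift : ℋ →L[ℂ] ℋ) (e j k) = ω • e (j - 1) k := fun j k => by
    simp only [e, shift_single, ← lp.single_smul, smul_eq_mul]
    rw [← mul_assoc, ← zpow_one_add₀ hω0]
    simp
    congr 2
    ring
  have hD : ∀ j k, (leftShift : ℋ →L[ℂ] ℋ) (e j k) = η • e j (k - 1) := fun j k => by
    simp only [e, shift_single, ← lp.single_smul, smul_eq_mul]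
    rw [mul_left_comm, ← zpow_one_add₀ hη0]
    simp
    congr 2
    ring
  let v : ℕ → ℋ := fun n => ∑ j ∈ Finset.range (n + 1), ∑ k ∈ Finset.range (n + 1), e j k
  have hv : ∀ n, ‖v n‖ = √((n + 1 : ℕ) : ℝ) * √((n + 1 : ℕ) : ℝ) := fun n => by
    have := norm_sum_single (Finset.range (n + 1) ×ˢ Finset.range (n + 1))
      (φ := fun p : ℕ × ℕ => ((p.1 : ℤ) + p.2 + 1, (p.1 : ℤ)))
      (fun i j h => by
        simp only [Prod.mk.injEq] at h
        exact Prod.ext (by omega) (by omega))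
      (c := fun p : ℕ × ℕ => ω ^ (p.1 : ℤ) * η ^ (p.2 : ℤ)) (by simp [hω, hη])
    rw [Finset.sum_product, Finset.card_product, Finset.card_range, Nat.cast_mul,
      Real.sqrt_mul (by positivity)] at this
    exact this
  have hrow : ∀ (n : ℕ) (j : ℤ), ‖∑ k ∈ Finset.range (n + 1), e j k‖ = √((n + 1 : ℕ) : ℝ) :=
    fun n j => by
      have := norm_sum_single (Finset.range (n + 1)) (φ := fun k : ℕ => (j + k + 1, j))
        (fun i k h => by simpa using h) (c := fun k : ℕ => ω ^ j * η ^ (k : ℤ)) (by simp [hω, hη])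
      rwa [Finset.card_range] at this
  have hcol : ∀ (n : ℕ) (k : ℤ), ‖∑ j ∈ Finset.range (n + 1), e j k‖ = √((n + 1 : ℕ) : ℝ) :=
    fun n k => by
      have := norm_sum_single (Finset.range (n + 1)) (φ := fun j : ℕ => ((j : ℤ) + k + 1, (j : ℤ)))
        (fun i k h => by simp only [Prod.mk.injEq] at h; omega)
        (c := fun j : ℕ => ω ^ (j : ℤ) * η ^ k) (by simp [hω, hη])
      rwa [Finset.card_range] at this
  have hpos : ∀ n : ℕ, 0 < √((n + 1 : ℕ) : ℝ) := fun n => Real.sqrt_pos.2 (by positivity)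
  have hinv : ∀ (n : ℕ), ‖(((√((n + 1 : ℕ) : ℝ) * √((n + 1 : ℕ) : ℝ) : ℝ) : ℂ))⁻¹‖
      = (√((n + 1 : ℕ) : ℝ) * √((n + 1 : ℕ) : ℝ))⁻¹ := fun n => by
    rw [norm_inv, Complex.norm_real, Real.norm_of_nonneg (by positivity)]
  have hbound : ∀ (n : ℕ) (r : ℝ), r ≤ 2 * √((n + 1 : ℕ) : ℝ) →
      (√((n + 1 : ℕ) : ℝ) * √((n + 1 : ℕ) : ℝ))⁻¹ * r ≤ 2 / √((n + 1 : ℕ) : ℝ) := fun n r hr => by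
    have := hpos n
    rw [inv_mul_le_iff₀ (by positivity), mul_assoc, mul_div_cancel₀ _ this.ne']
    linarith
  refine ⟨fun n => (((√((n + 1 : ℕ) : ℝ) * √((n + 1 : ℕ) : ℝ) : ℝ) : ℂ))⁻¹ • v n,
    fun n => ?_, fun n x => ?_, ?_, ?_⟩
  · rw [norm_smul, hv, hinv, inv_mul_cancel₀ (mul_pos (hpos n) (hpos n)).ne']
  · rw [lp.coeFn_smul, Pi.smul_apply, lp.coeFn_sum, Finset.sum_apply, Finset.sum_eq_zero, smul_zero]
    intro j _
    rw [lp.coeFn_sum, Finset.sum_apply, Finset.sum_eq_zero]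
    intro k _
    exact lp.single_apply_ne _ _ _ fun h => by simp only [Prod.mk.injEq] at h; omega
  · refine squeeze_zero_norm (fun n => ?_) tendsto_two_div_sqrt
    rw [map_smul, smul_comm ω, ← smul_sub, norm_smul, hinv]
    refine hbound n _ ?_
    exact norm_sum_range_telescope_le _ hω (e := fun j => ∑ k ∈ Finset.range (n + 1), e j k)
      (fun j => by simp only [map_sum, hS, Finset.smul_sum]) (hrow n) (n + 1)
  · refine squeeze_zero_norm (fun n => ?_) tendsto_two_div_sqrt
    rw [map_smul, smul_comm η, ← smul_sub, norm_smul, hinv]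
    refine hbound n _ ?_
    simp only [v]
    rw [Finset.sum_comm]
    exact norm_sum_range_telescope_le _ hη (e := fun k => ∑ j ∈ Finset.range (n + 1), e j k)
      (fun j => by simp only [map_sum, hD, Finset.smul_sum]) (hcol n) (n + 1)

lemma coe_shift_mul (v w : Multiplicative (ℤ × ℤ)) :
    (shift v : ℋ →L[ℂ] ℋ) * shift w = shift (v * w) := by
  rw [map_mul]
  rfl

lemma coe_shift_pow (v : Multiplicative (ℤ × ℤ)) (n : ℕ) :
    (shift v : ℋ →L[ℂ] ℋ) ^ n = shift (v ^ n) := by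
  rw [map_pow]
  rfl

lemma freeGenerator_apply (ψ : ℋ) (x y : ℤ) :
    freeGenerator diagShift leftShift ψ (x, y)
      = Complex.I * (ψ (x + 1, y) + ψ (x - 1, y) - ψ (x, y + 1) - ψ (x, y - 1)) := by
  rw [freeGenerator, star_shift, star_shift, coe_shift_mul, coe_shift_mul]
  change Complex.I * ((shift _ : ℋ →L[ℂ] ℋ) ψ (x, y) + (shift _ : ℋ →L[ℂ] ℋ) ψ (x, y)
    - (shift _ : ℋ →L[ℂ] ℋ) ψ (x, y) - (shift _ : ℋ →L[ℂ] ℋ) ψ (x, y)) = _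
  simp only [shift_apply]
  simp [sub_eq_add_neg]

/-- `P` is the orthogonal projection onto the functions supported on the diagonal. -/
def IsDiagonalProjection (P : ℋ →L[ℂ] ℋ) : Prop :=
  ∀ (ψ : ℋ) (p : ℤ × ℤ), P ψ p = if p.1 = p.2 then ψ p else 0

namespace IsDiagonalProjection

variable {P : ℋ →L[ℂ] ℋ}

lemma mul_self (hP : IsDiagonalProjection P) : P * P = P := by
  ext ψ p
  change P (P ψ) p = P ψ p
  simp only [hP _ _]
  split_ifs <;> rfl

lemma commute_diagShift (hP : IsDiagonalProjection P) : Commute (diagShift : ℋ →L[ℂ] ℋ) P := by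
  ext ψ p
  change (diagShift : ℋ →L[ℂ] ℋ) (P ψ) p = P ((diagShift : ℋ →L[ℂ] ℋ) ψ) p
  simp [shift_apply, hP _ _]

lemma mul_shift_mul (hP : IsDiagonalProjection P) {v : ℤ × ℤ} (hv : v.1 ≠ v.2) :
    P * (shift (Multiplicative.ofAdd v) : ℋ →L[ℂ] ℋ) * P = 0 := by
  ext ψ p
  change P ((shift (Multiplicative.ofAdd v) : ℋ →L[ℂ] ℋ) (P ψ)) p = 0
  rw [hP, shift_apply, hP]
  split_ifs with h1 h2
  · simp only [Prod.fst_add, Prod.snd_add, toAdd_ofAdd] at h2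
    omega
  · rfl
  · rfl

lemma mul_leftShift_pow_mul (hP : IsDiagonalProjection P) (n : ℕ) :
    P * (leftShift : ℋ →L[ℂ] ℋ) ^ (n + 1) * P = 0 := by
  rw [coe_shift_pow, ← ofAdd_nsmul]
  exact hP.mul_shift_mul (by simp; omega)

lemma mul_star_leftShift_pow_mul (hP : IsDiagonalProjection P) (n : ℕ) :
    P * star (leftShift : ℋ →L[ℂ] ℋ) ^ (n + 1) * P = 0 := by
  rw [star_shift, coe_shift_pow, ← ofAdd_neg, ← ofAdd_nsmul]
  exact hP.mul_shift_mul (by simp; omega)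

end IsDiagonalProjection

/-- The algebraic form of the incoherent hopping generator. -/
noncomputable def hoppingGenerator (G : ℂ) (l : ℤ) (P : ℋ →L[ℂ] ℋ) : ℋ →L[ℂ] ℋ :=
  freeGenerator diagShift leftShift - algebraMap ℂ _ G
    + G • (((diagShift ^ l : unitary (ℋ →L[ℂ] ℋ)) : ℋ →L[ℂ] ℋ) * P)

lemma exists_eq_hoppingGenerator {G : ℂ} (hG : G ≠ 0) (l : ℤ) (L : ℋ →L[ℂ] ℋ)
    (hL : ∀ (ψ : ℋ) (x y : ℤ),
      L ψ (x, y) = Complex.I * (ψ (x + 1, y) + ψ (x - 1, y) - ψ (x, y + 1) - ψ (x, y - 1))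
        - G * ψ (x, y) + G * (if x = y then ψ (x + l, y + l) else 0)) :
    ∃ P, IsDiagonalProjection P ∧ L = hoppingGenerator G l P := by
  let K : ℋ →L[ℂ] ℋ := L - freeGenerator diagShift leftShift + algebraMap ℂ _ G
  have hK : ∀ (ψ : ℋ) (x y : ℤ), K ψ (x, y) = G * (if x = y then ψ (x + l, y + l) else 0) := by
    intro ψ x y
    change L ψ (x, y) - freeGenerator diagShift leftShift ψ (x, y) + G * ψ (x, y) = _
    rw [hL, freeGenerator_apply]
    ring
  refine ⟨G⁻¹ • (((diagShift ^ (-l) : unitary (ℋ →L[ℂ] ℋ)) : ℋ →L[ℂ] ℋ) * K), ?_, ?_⟩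
  · rintro ψ ⟨x, y⟩
    rw [← map_zpow, ← ofAdd_zsmul]
    change G⁻¹ * ((shift (Multiplicative.ofAdd ((-l) • ((1, 1) : ℤ × ℤ))) : ℋ →L[ℂ] ℋ) (K ψ) (x, y))
      = _
    rw [shift_apply]
    have : (x, y) + (-l) • ((1, 1) : ℤ × ℤ) = (x + -l, y + -l) := by simp
    rw [toAdd_ofAdd, this, hK, inv_mul_cancel_left₀ hG]
    simp
  · rw [hoppingGenerator, mul_smul_comm, smul_inv_smul₀ hG, ← mul_assoc]
    have : ((diagShift ^ l : unitary (ℋ →L[ℂ] ℋ)) : ℋ →L[ℂ] ℋ) *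
        ((diagShift ^ (-l) : unitary (ℋ →L[ℂ] ℋ)) : ℋ →L[ℂ] ℋ) = 1 := by
      rw [← Submonoid.coe_mul, ← zpow_add, add_neg_cancel, zpow_zero]
      rfl
    rw [this, one_mul]
    simp only [K]
    abel

lemma neg_add_mem_spectrum_hoppingGenerator_iff (G z : ℂ) (l : ℤ) (P : ℋ →L[ℂ] ℋ) :
    -G + z ∈ spectrum ℂ (hoppingGenerator G l P) ↔
      ¬IsUnit (algebraMap ℂ (ℋ →L[ℂ] ℋ) z - freeGenerator diagShift leftShift
        - G • (((diagShift ^ l : unitary (ℋ →L[ℂ] ℋ)) : ℋ →L[ℂ] ℋ) * P)) := by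
  rw [spectrum.mem_iff, hoppingGenerator, map_add, map_neg]
  congr! 2
  abel

lemma mem_spectrum_hoppingGenerator_of_notMem {G z : ℂ} (hz : z ∉ imaginarySegment) (l : ℤ)
    {P : ℋ →L[ℂ] ℋ} (hP : IsDiagonalProjection P) :
    -G + z ∈ spectrum ℂ (hoppingGenerator G l P) ↔
      ∃ ζ : ℂ, ‖ζ‖ = 1 ∧ dispersionRoot z ζ = G * ζ ^ l := by
  rw [neg_add_mem_spectrum_hoppingGenerator_iff, isUnit_sub_freeGenerator_iff
    ((Commute.all _ _).map shift) hP.commute_diagShift hP.mul_self hP.mul_leftShift_pow_mul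
    hP.mul_star_leftShift_pow_mul hz]
  constructor
  · contrapose!
    intro h
    refine isUnit_one_sub_calculus_mul hP.commute_diagShift hP.mul_self fun ζ h1 => ?_
    have hζ := norm_eq_one_of_mem_spectrum _ ζ
    exact h ζ hζ ((div_eq_one_iff_eq (dispersionRoot_ne_zero hz hζ)).1 h1).symm
  · rintro ⟨ζ, hζ, h⟩
    obtain ⟨u, hu, hdiag, hS⟩ := exists_diagonal_approx hζ
    have hPu : ∀ n, P (u n) = u n := fun n => by
      ext ⟨x, y⟩
      rw [hP]
      split_ifs with hxy
      · rfl
      · exact (hdiag n x y hxy).symm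
    refine not_isUnit_of_tendsto hu ?_
    have h1 := (tendsto_unitaryCalculus hu ⟨ζ, mem_spectrum_of_tendsto hu hS⟩ hS
      (reducedSymbol diagShift hz G l)).neg
    have h2 : reducedSymbol diagShift hz G l ⟨ζ, mem_spectrum_of_tendsto hu hS⟩ = 1 :=
      (div_eq_one_iff_eq (dispersionRoot_ne_zero hz hζ)).2 h.symm
    rw [h2, neg_zero] at h1
    refine h1.congr fun n => ?_
    simp [hPu]

lemma mem_spectrum_hoppingGenerator_of_mem {z : ℂ} (hz : z ∈ imaginarySegment) (G : ℂ) (l : ℤ)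
    {P : ℋ →L[ℂ] ℋ} (hP : IsDiagonalProjection P) :
    -G + z ∈ spectrum ℂ (hoppingGenerator G l P) := by
  rw [neg_add_mem_spectrum_hoppingGenerator_iff]
  obtain ⟨t, h1, h2, rfl⟩ := hz
  set η := Complex.exp (Real.arccos (t / 4) * Complex.I) with hη
  have hη1 : ‖η‖ = 1 := Complex.norm_exp_ofReal_mul_I _
  have hη0 : η ≠ 0 := Complex.exp_ne_zero _
  have ht : Complex.I * t = 2 * Complex.I * (η + η⁻¹) := by
    have h3 : Complex.cos (Real.arccos (t / 4)) = (t / 4 : ℝ) := by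
      rw [← Complex.ofReal_cos, Real.cos_arccos (by linarith) (by linarith)]
    rw [hη, ← Complex.exp_neg, ← neg_mul, ← Complex.two_cos, h3]
    push_cast
    ring
  obtain ⟨u, hu, hoff, hS, hD⟩ := exists_offDiagonal_approx (ω := -1) (by simp) hη1
  have hPu : ∀ n, P (u n) = 0 := fun n => by
    ext ⟨x, y⟩
    rw [hP]
    split_ifs with hxy
    · obtain rfl : x = y := hxy
      exact hoff n x
    · rfl
  refine not_isUnit_of_tendsto hu ?_
  have h3 := ((((-2 * Complex.I) • (1 - η⁻¹ • star (leftShift : ℋ →L[ℂ] ℋ))).continuous.tendsto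
    0).comp hD).add (((Complex.I • (star (leftShift : ℋ →L[ℂ] ℋ)
      + leftShift * star (diagShift : ℋ →L[ℂ] ℋ))).continuous.tendsto 0).comp hS)
  rw [map_zero, map_zero, add_zero] at h3
  refine h3.congr fun n => ?_
  have h4 : star (leftShift : ℋ →L[ℂ] ℋ) ((leftShift : ℋ →L[ℂ] ℋ) (u n)) = u n :=
    congrArg (fun X : ℋ →L[ℂ] ℋ => X (u n)) (Unitary.star_mul_self_of_mem leftShift.2)
  have h5 : star (diagShift : ℋ →L[ℂ] ℋ) ((diagShift : ℋ →L[ℂ] ℋ) (u n)) = u n :=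
    congrArg (fun X : ℋ →L[ℂ] ℋ => X (u n)) (Unitary.star_mul_self_of_mem diagShift.2)
  simp only [Function.comp_apply, smul_apply, sub_apply,
    add_apply, mul_apply_eq_comp, one_apply_eq_self,
    map_sub, map_smul, h4, h5, hPu, map_zero, smul_zero, sub_zero, ht, freeGenerator,
    Algebra.algebraMap_eq_smul_one]
  generalize star (leftShift : ℋ →L[ℂ] ℋ) ((diagShift : ℋ →L[ℂ] ℋ) (u n)) = a
  match_scalars <;> field_simp <;> ring

end Lattice

section Branch

/-- For each `ζ` on the unit circle at most one `z` off the segment lies on the branch of the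
dispersion relation. -/
lemma eq_of_dispersionRoot_eq {z z' c ζ : ℂ} (hc : c ≠ 0) (hz : z ∉ imaginarySegment)
    (hz' : z' ∉ imaginarySegment) (h : dispersionRoot z ζ = c) (h' : dispersionRoot z' ζ = c) :
    z = z' := by
  have h1 := dispersionRoot_sq (ne_zero_of_notMem_imaginarySegment hz) ζ
  have h2 := dispersionRoot_sq (ne_zero_of_notMem_imaginarySegment hz') ζ
  rw [h] at h1
  rw [h'] at h2
  rcases sq_eq_sq_iff_eq_or_eq_neg.1 (by linear_combination h2 - h1 : z ^ 2 = z' ^ 2) with e | e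
  · exact e
  · rw [e, dispersionRoot_neg, h'] at h
    exact absurd (self_eq_neg.1 h.symm) hc

/-- There is a square root of `c² - 8(1 - Re ζ)` which detects the solutions of
`dispersionRoot z ζ = c` off the segment. -/
lemma exists_sqrt_dispersion {c : ℂ} (hc : c ≠ 0) (ζ : ℂ) : ∃ w : ℂ,
    w ^ 2 = c ^ 2 - ((8 - 8 * ζ.re : ℝ) : ℂ) ∧
    ∀ z ∉ imaginarySegment, dispersionRoot z ζ = c ↔ z = w := by
  by_cases h : ∃ z ∉ imaginarySegment, dispersionRoot z ζ = c
  · obtain ⟨w, hw, h⟩ := h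
    refine ⟨w, ?_, fun z hz => ⟨fun h' => eq_of_dispersionRoot_eq hc hz hw h' h, fun h' => h' ▸ h⟩⟩
    rw [← h, dispersionRoot_sq (ne_zero_of_notMem_imaginarySegment hw)]
    ring
  · push Not at h
    obtain ⟨w, hw⟩ := IsAlgClosed.exists_pow_nat_eq
      (c ^ 2 - ((8 - 8 * ζ.re : ℝ) : ℂ)) (n := 2) (by norm_num)
    refine ⟨w, hw, fun z hz => ⟨fun h' => absurd h' (h z hz), ?_⟩⟩
    rintro rfl
    have h1 := dispersionRoot_sq (ne_zero_of_notMem_imaginarySegment hz) ζ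
    rcases sq_eq_sq_iff_eq_or_eq_neg.1 (h1.trans (by rw [hw]; ring) :
      dispersionRoot z ζ ^ 2 = c ^ 2) with e | e
    · exact e
    · refine absurd ?_ (h (-z) fun hn => hz (by simpa using neg_mem_imaginarySegment hn))
      rw [dispersionRoot_neg, e, neg_neg]

lemma exists_mem_Icc_exp_eq {ζ : ℂ} (hζ : ‖ζ‖ = 1) :
    ∃ q ∈ Set.Icc (0 : ℝ) (2 * π), Complex.exp (-(q * Complex.I)) = ζ := by
  have h := toIcoMod_mem_Ico (two_pi_pos) 0 (-ζ.arg)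
  rw [zero_add] at h
  refine ⟨_, ⟨h.1, h.2.le⟩, ?_⟩
  have h2 := self_sub_toIcoDiv_zsmul two_pi_pos 0 (-ζ.arg)
  rw [← h2]
  have : -((((-ζ.arg - toIcoDiv two_pi_pos 0 (-ζ.arg) • (2 * π) : ℝ)) : ℂ) * Complex.I)
      = ζ.arg * Complex.I + (toIcoDiv two_pi_pos 0 (-ζ.arg) : ℤ) * (2 * π * Complex.I) := by
    push_cast [zsmul_eq_mul]
    ring
  rw [this, Complex.exp_add, Complex.exp_int_mul_two_pi_mul_I, mul_one]
  simpa [hζ] using Complex.norm_mul_exp_arg_mul_I ζ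

end Branch

/-- Spectrum of the Lindbladian with incoherent hopping (`L_k = |e_k⟩⟨e_{k+l}|`): for the
operator `(𝓛ψ)(x,y) = i(ψ(x+1,y) + ψ(x-1,y) - ψ(x,y+1) - ψ(x,y-1)) - Gψ(x,y)
+ G·δ_{xy}·ψ(x+l,y+l)` on `ℓ²(ℤ×ℤ)` with `G > 0`, there is a choice of square roots
`w(q)` of `e^{-2iql}G² + 8(cos q - 1)` such that
`σ(𝓛) = (-G + i[-4,4]) ∪ {-G + w(q) : q ∈ [0,2π]}`. -/
theorem spectrum_lindblad_incoherent_hopping (G : ℝ) (hG : 0 < G) (l : ℤ)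
    (L : lp (fun _ : ℤ × ℤ => ℂ) 2 →L[ℂ] lp (fun _ : ℤ × ℤ => ℂ) 2)
    (hL : ∀ (ψ : lp (fun _ : ℤ × ℤ => ℂ) 2) (x y : ℤ),
      L ψ (x, y) = Complex.I * (ψ (x + 1, y) + ψ (x - 1, y) - ψ (x, y + 1) - ψ (x, y - 1))
        - (G : ℂ) * ψ (x, y) + (G : ℂ) * (if x = y then ψ (x + l, y + l) else 0)) :
    ∃ w : ℝ → ℂ,
      (∀ q ∈ Set.Icc (0 : ℝ) (2 * π),
        (w q) ^ 2 = Complex.exp (-2 * Complex.I * (q : ℂ) * (l : ℂ)) * (G : ℂ) ^ 2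
          + 8 * ((Real.cos q : ℂ) - 1)) ∧
      spectrum ℂ L =
        {z : ℂ | ∃ t : ℝ, -4 ≤ t ∧ t ≤ 4 ∧ z = -(G : ℂ) + Complex.I * (t : ℂ)} ∪
        {z : ℂ | ∃ q ∈ Set.Icc (0 : ℝ) (2 * π), z = -(G : ℂ) + w q} := by
  have hG0 : (G : ℂ) ≠ 0 := by exact_mod_cast hG.ne'
  obtain ⟨P, hP, rfl⟩ := exists_eq_hoppingGenerator hG0 l L hL
  let ζ : ℝ → ℂ := fun q => Complex.exp (-(q * Complex.I))
  have hζ : ∀ q, ‖ζ q‖ = 1 := fun q => by simp [ζ, Complex.norm_exp]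
  choose w hw hwz using fun q : ℝ => exists_sqrt_dispersion
    (mul_ne_zero hG0 (zpow_ne_zero l (Complex.exp_ne_zero (-(q * Complex.I))))) (ζ q)
  refine ⟨w, fun q _ => ?_, Set.ext fun μ => ?_⟩
  · have h1 : (ζ q).re = Real.cos q := by
      simp [ζ, Complex.exp_re]
    have h2 : (Complex.exp (-(q * Complex.I)) ^ l) ^ 2
        = Complex.exp (-2 * Complex.I * (q : ℂ) * (l : ℂ)) := by
      rw [← Complex.exp_int_mul, ← Complex.exp_nat_mul]
      congr 1
      push_cast
      ring
    rw [hw, h1, mul_pow, h2]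
    push_cast
    ring
  obtain ⟨z, rfl⟩ : ∃ z, μ = -(G : ℂ) + z := ⟨G + μ, by ring⟩
  simp only [Set.mem_union, Set.mem_ofPred_eq, add_right_inj]
  by_cases hz : z ∈ imaginarySegment
  · exact iff_of_true (mem_spectrum_hoppingGenerator_of_mem hz G l hP) (Or.inl hz)
  · rw [mem_spectrum_hoppingGenerator_of_notMem hz l hP]
    constructor
    · rintro ⟨ξ, hξ, h⟩
      obtain ⟨q, hq, rfl⟩ := exists_mem_Icc_exp_eq hξ
      exact Or.inr ⟨q, hq, (hwz q z hz).1 h⟩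
    · rintro (h | ⟨q, -, h⟩)
      · exact absurd h hz
      · exact ⟨ζ q, hζ q, (hwz q z hz).2 h⟩
end
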